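/- arXiv:0805.1069 — 3 statements merged into one kernel-verified Lean document; each statement's English description precedes it below -/
import Mathlib

section
/- If f : ℂ → ℂ is a surjective oriented map (for every simple closed curve S and every x ∈ T(S), f(x) ∈ T(f(S))), then f is confluent: for every subcontinuum K ⊂ ℂ and every connected component C of f⁻¹(K), f(C) = K. -/
open Set

/-- The topological hull of a set `S ⊂ ℂ`. -/
def topHull (S : Set ℂ) : Set ℂ :=
  S ∪ {z | z ∉ S ∧ Bornology.IsBounded (connectedComponentIn Sᶜ z)}

/-- A parameterized simple closed curve in the plane. -/
def JordanLoop (γ : ℝ → ℂ) : Prop :=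
  Continuous γ ∧ Function.Periodic γ 1 ∧ Set.InjOn γ (Set.Ico 0 1)

/-- Two lattice points are joined by a unit edge of the integer grid. -/
def IsGridStep (p q : ℤ × ℤ) : Prop :=
  (q.1 = p.1 + 1 ∧ q.2 = p.2) ∨ (p.1 = q.1 + 1 ∧ q.2 = p.2) ∨
    (q.1 = p.1 ∧ q.2 = p.2 + 1) ∨ (q.1 = p.1 ∧ p.2 = q.2 + 1)

/-- The value at the unit edge `pq` of the mod 2 boundary of the 2-chain `g`, where `g (i, j)` is
the coefficient of the unit square with lower left corner `(i, j)`. -/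
def gridBoundary (g : ℤ × ℤ → ZMod 2) (p q : ℤ × ℤ) : ZMod 2 :=
  if q.1 = p.1 + 1 ∧ q.2 = p.2 then g p + g (p.1, p.2 - 1)
  else if p.1 = q.1 + 1 ∧ q.2 = p.2 then g q + g (q.1, q.2 - 1)
  else if q.1 = p.1 ∧ q.2 = p.2 + 1 then g p + g (p.1 - 1, p.2)
  else if q.1 = p.1 ∧ p.2 = q.2 + 1 then g q + g (q.1 - 1, q.2)
  else 0

theorem gridBoundary_symm (g : ℤ × ℤ → ZMod 2) (p q : ℤ × ℤ) :
    gridBoundary g p q = gridBoundary g q p := by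
  unfold gridBoundary
  split_ifs <;> first | rfl | omega

theorem isGridStep_of_gridBoundary_ne_zero {g : ℤ × ℤ → ZMod 2} {p q : ℤ × ℤ}
    (h : gridBoundary g p q ≠ 0) : IsGridStep p q := by
  unfold gridBoundary at h
  unfold IsGridStep
  split_ifs at h <;> tauto

theorem gridBoundary_add (g h : ℤ × ℤ → ZMod 2) (p q : ℤ × ℤ) :
    gridBoundary (g + h) p q = gridBoundary g p q + gridBoundary h p q := by
  unfold gridBoundary
  split_ifs <;> simp only [Pi.add_apply, add_zero] <;> ring

theorem gridBoundary_sum {ι : Type*} (s : Finset ι) (g : ι → ℤ × ℤ → ZMod 2) (p q : ℤ × ℤ) :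
    gridBoundary (fun x => ∑ k ∈ s, g k x) p q = ∑ k ∈ s, gridBoundary (g k) p q := by
  unfold gridBoundary
  split_ifs <;> simp only [Finset.sum_add_distrib, Finset.sum_const_zero]

theorem exists_gridBoundary_ne_zero_of_ne {g : ℤ × ℤ → ZMod 2} {p q : ℤ × ℤ}
    (h : gridBoundary g p q ≠ 0) : ∃ r, gridBoundary g q r ≠ 0 ∧ r ≠ p := by
  obtain ⟨a, b⟩ := q
  have hne1 : ∀ t : ℤ, t - 1 ≠ t + 1 := fun t => by omega
  have hne2 : ∀ t : ℤ, t + 1 ≠ t - 1 := fun t => by omega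
  have hne3 : ∀ t : ℤ, t + 1 + 1 ≠ t := fun t => by omega
  have hsum : gridBoundary g (a, b) (a + 1, b) + gridBoundary g (a, b) (a - 1, b) +
      gridBoundary g (a, b) (a, b + 1) + gridBoundary g (a, b) (a, b - 1) = 0 := by
    simp [gridBoundary, hne1]
    generalize g (a, b) = w
    generalize g (a, b - 1) = x
    generalize g (a - 1, b) = y
    generalize g (a - 1, b - 1) = z
    revert w x y z
    decide
  by_contra! hcon
  have h' := h
  rw [gridBoundary_symm] at h'
  have hstep := isGridStep_of_gridBoundary_ne_zero h'
  have key : ∀ r, r ≠ p → gridBoundary g (a, b) r = 0 := fun r hr => by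
    by_contra h0
    exact hr (hcon r h0)
  obtain ⟨x, y⟩ := p
  simp only [IsGridStep] at hstep
  rcases hstep with ⟨rfl, rfl⟩ | ⟨rfl, rfl⟩ | ⟨rfl, rfl⟩ | ⟨rfl, rfl⟩
  all_goals
    apply h'
    simpa [key, Prod.ext_iff, hne1, hne2, hne3] using hsum

/-- A finite graph without dead ends contains a simple cycle. -/
theorem exists_simple_cycle {α : Type*} {r : α → α → Prop} (hirr : ∀ p, ¬ r p p)
    (hfin : {p | ∃ q, r p q}.Finite) (hnext : ∀ p q, r p q → ∃ s, r q s ∧ s ≠ p)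
    (hne : ∃ p q, r p q) :
    ∃ (n : ℕ) (c : ℕ → α), 3 ≤ n ∧ c n = c 0 ∧ InjOn c (Iio n) ∧
      ∀ k < n, r (c k) (c (k + 1)) := by
  obtain ⟨p, q, hpq⟩ := hne
  choose! nxt hr hback using hnext
  let e : ℕ → {e : α × α // r e.1 e.2} := fun k =>
    (fun e => ⟨(e.1.2, nxt e.1.1 e.1.2), hr _ _ e.2⟩)^[k] ⟨(p, q), hpq⟩
  have he : ∀ k, (e (k + 1)).1 = ((e k).1.2, nxt (e k).1.1 (e k).1.2) := fun k => by
    simp only [e, Function.iterate_succ_apply']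
  let w : ℕ → α := fun k => (e k).1.1
  have hw1 : ∀ k, w (k + 1) = (e k).1.2 := fun k => by simp only [w, he]
  have hw2 : ∀ k, w (k + 2) ≠ w k := fun k => by
    rw [hw1 (k + 1), he]
    exact hback _ _ (e k).2
  have hwr : ∀ k, r (w k) (w (k + 1)) := fun k => by
    rw [hw1]
    exact (e k).2
  have hrep : ∃ n, 0 < n ∧ ∃ i, w (i + n) = w i := by
    have hninj : ¬ Function.Injective w := fun hinj =>
      (Set.infinite_range_of_injective hinj) (hfin.subset (by
        rintro _ ⟨k, rfl⟩
        exact ⟨_, hwr k⟩))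
    simp only [Function.Injective] at hninj
    push Not at hninj
    obtain ⟨a, b, hab, hne⟩ := hninj
    rcases lt_or_gt_of_ne hne with h | h
    · exact ⟨b - a, by omega, a, by rw [Nat.add_sub_cancel' h.le, hab]⟩
    · exact ⟨a - b, by omega, b, by rw [Nat.add_sub_cancel' h.le, hab]⟩
  classical
  obtain ⟨hpos, i, hi⟩ := Nat.find_spec hrep
  have hmin := fun m hm => Nat.find_min hrep (m := m) hm
  generalize Nat.find hrep = n at *
  have hinj : ∀ a b, a < b → b < n → w (i + a) ≠ w (i + b) := fun a b hab hb heq =>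
    hmin (b - a) (by omega) ⟨by omega, i + a, by
      rw [heq]; congr 1; omega⟩
  refine ⟨n, fun k => w (i + k), ?_, hi, ?_, fun k _ => hwr _⟩
  · by_contra hn
    have : n = 1 ∨ n = 2 := by omega
    rcases this with rfl | rfl
    · have := hwr i
      rw [hi] at this
      exact hirr _ this
    · exact hw2 i hi
  · intro a ha b hb hab
    rcases lt_trichotomy a b with h | h | h
    · exact (hinj a b h hb hab).elim
    · exact h
    · exact (hinj b a h ha hab.symm).elim

/-- The mod 2 intersection number of the grid step `pq` with the horizontal ray going right from
the centre of the unit square with lower left corner `s`. -/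
def stepCrossing (p q s : ℤ × ℤ) : ZMod 2 :=
  if p.1 = q.1 ∧ s.1 < p.1 ∧ ((p.2 = s.2 ∧ q.2 = s.2 + 1) ∨ (q.2 = s.2 ∧ p.2 = s.2 + 1))
  then 1 else 0

/-- The mod 2 winding number of the grid path `c 0, …, c n` around a unit square. -/
def crossingParity (c : ℕ → ℤ × ℤ) (n : ℕ) (s : ℤ × ℤ) : ZMod 2 :=
  ∑ k ∈ Finset.range n, stepCrossing (c k) (c (k + 1)) s

theorem sum_range_add_succ_eq_zero {c : ℕ → ℤ × ℤ} {n : ℕ} (hc : c n = c 0)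
    (φ : ℤ × ℤ → ZMod 2) : ∑ k ∈ Finset.range n, (φ (c k) + φ (c (k + 1))) = 0 := by
  have h := Finset.sum_range_sub (fun k => φ (c k)) n
  simp only [hc, sub_self, CharTwo.sub_eq_add] at h
  rw [← h]
  exact Finset.sum_congr rfl fun _ _ => add_comm _ _

theorem gridBoundary_stepCrossing {p q : ℤ × ℤ} (hpq : IsGridStep p q) :
    ∃ φ : ℤ × ℤ → ZMod 2, ∀ P Q, IsGridStep P Q → gridBoundary (stepCrossing P Q) p q =
      (if (P = p ∧ Q = q) ∨ (P = q ∧ Q = p) then 1 else 0) + (φ P + φ Q) := by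
  wlog h : (q.1 = p.1 + 1 ∧ q.2 = p.2) ∨ (q.1 = p.1 ∧ q.2 = p.2 + 1) generalizing p q
  · obtain ⟨φ, hφ⟩ := this (p := q) (q := p) (by unfold IsGridStep at *; omega)
      (by unfold IsGridStep at *; omega)
    refine ⟨φ, fun P Q hPQ => ?_⟩
    rw [gridBoundary_symm, hφ P Q hPQ]
    simp only [or_comm]
  obtain ⟨a, b⟩ := p
  obtain ⟨a', b'⟩ := q
  simp only at h
  rcases h with ⟨rfl, rfl⟩ | ⟨rfl, rfl⟩
  · refine ⟨fun v => if a < v.1 ∧ v.2 = b' then 1 else 0, ?_⟩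
    rintro ⟨x, y⟩ ⟨x', y'⟩ hPQ
    simp only [IsGridStep] at hPQ
    rcases hPQ with ⟨rfl, rfl⟩ | ⟨rfl, rfl⟩ | ⟨rfl, rfl⟩ | ⟨rfl, rfl⟩ <;>
    simp only [gridBoundary, stepCrossing, Prod.ext_iff, and_self, true_and, if_true] <;>
    split_ifs <;> first | omega | rfl
  · refine ⟨fun v => 0, ?_⟩
    rintro ⟨x, y⟩ ⟨x', y'⟩ hPQ
    simp only [IsGridStep] at hPQ
    rcases hPQ with ⟨rfl, rfl⟩ | ⟨rfl, rfl⟩ | ⟨rfl, rfl⟩ | ⟨rfl, rfl⟩ <;>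
    simp only [gridBoundary, stepCrossing, Prod.ext_iff, and_self, true_and, if_true] <;>
    split_ifs <;> first | omega | rfl

theorem gridBoundary_crossingParity {c : ℕ → ℤ × ℤ} {n : ℕ} (hc : c n = c 0)
    (hstep : ∀ k < n, IsGridStep (c k) (c (k + 1))) {p q : ℤ × ℤ} (hpq : IsGridStep p q) :
    gridBoundary (crossingParity c n) p q = ∑ k ∈ Finset.range n,
      if (c k = p ∧ c (k + 1) = q) ∨ (c k = q ∧ c (k + 1) = p) then 1 else 0 := by
  obtain ⟨φ, hφ⟩ := gridBoundary_stepCrossing hpq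
  have h : crossingParity c n = fun s => ∑ k ∈ Finset.range n,
    stepCrossing (c k) (c (k + 1)) s := rfl
  rw [h, gridBoundary_sum, Finset.sum_congr rfl fun k hk =>
    hφ _ _ (hstep k (Finset.mem_range.1 hk)), Finset.sum_add_distrib,
    sum_range_add_succ_eq_zero hc, add_zero]

theorem exists_step_of_gridBoundary_crossingParity_ne_zero {c : ℕ → ℤ × ℤ} {n : ℕ}
    (hc : c n = c 0) (hstep : ∀ k < n, IsGridStep (c k) (c (k + 1))) {p q : ℤ × ℤ}
    (h : gridBoundary (crossingParity c n) p q ≠ 0) :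
    ∃ k < n, (c k = p ∧ c (k + 1) = q) ∨ (c k = q ∧ c (k + 1) = p) := by
  rw [gridBoundary_crossingParity hc hstep (isGridStep_of_gridBoundary_ne_zero h)] at h
  obtain ⟨k, hk, hk'⟩ := Finset.exists_ne_zero_of_sum_ne_zero h
  exact ⟨k, Finset.mem_range.1 hk, by_contra fun h' => hk' (if_neg h')⟩

theorem gridBoundary_crossingParity_zero_one_ne_zero {c : ℕ → ℤ × ℤ} {n : ℕ} (hn : 3 ≤ n)
    (hc : c n = c 0) (hinj : InjOn c (Iio n)) (hstep : ∀ k < n, IsGridStep (c k) (c (k + 1))) :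
    gridBoundary (crossingParity c n) (c 0) (c 1) ≠ 0 := by
  rw [gridBoundary_crossingParity hc hstep (hstep 0 (by omega)),
    Finset.sum_eq_single_of_mem 0 (Finset.mem_range.2 (by omega))]
  · simp
  · intro k hk hk0
    have hk := Finset.mem_range.1 hk
    have h0 : c k ≠ c 0 := fun h => hk0 (hinj hk (show 0 < n by omega) h)
    rw [if_neg]
    rintro (⟨h, -⟩ | ⟨h, h'⟩)
    · exact h0 h
    · have : k = 1 := hinj hk (show 1 < n by omega) h
      subst this
      have := hinj (show 2 < n by omega) (show 0 < n by omega) h'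
      omega

theorem finite_support_crossingParity {c : ℕ → ℤ × ℤ} {n : ℕ} (hc : c n = c 0)
    (hstep : ∀ k < n, IsGridStep (c k) (c (k + 1))) :
    (Function.support (crossingParity c n)).Finite := by
  obtain ⟨M, hM⟩ : ∃ M : ℤ, ∀ k ≤ n, |(c k).1| ≤ M ∧ |(c k).2| ≤ M := by
    refine ⟨∑ k ∈ Finset.range (n + 1), (|(c k).1| + |(c k).2|), fun k hk => ?_⟩
    have := Finset.single_le_sum (f := fun k => |(c k).1| + |(c k).2|)
      (fun k _ => by positivity) (Finset.mem_range.2 (Nat.lt_succ_of_le hk))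
    have h1 := abs_nonneg (c k).1
    have h2 := abs_nonneg (c k).2
    constructor <;> linarith
  refine (Set.finite_Icc (-M - 1, -M - 1) (M, M)).subset ?_
  rintro ⟨i, j⟩ hs
  by_contra hout
  apply hs
  simp only [mem_Icc, Prod.mk_le_mk, not_and_or, not_le] at hout
  have key : i < -M - 1 ∨ crossingParity c n (i, j) = 0 := by
    rw [or_iff_not_imp_left]
    intro hi
    refine Finset.sum_eq_zero fun k hk => ?_
    have hk := Finset.mem_range.1 hk
    have h1 := hM k (by omega)
    have h2 := hM (k + 1) (by omega)
    rw [abs_le, abs_le] at h1 h2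
    rw [stepCrossing, if_neg]
    dsimp only
    omega
  rcases key with hi | h
  · rw [← sum_range_add_succ_eq_zero hc fun v => if j < v.2 then 1 else 0]
    refine Finset.sum_congr rfl fun k hk => ?_
    have hk := Finset.mem_range.1 hk
    have h1 := hM k (by omega)
    have h2 := hstep k hk
    rw [abs_le, abs_le] at h1
    unfold IsGridStep at h2
    unfold stepCrossing
    split_ifs <;> first | (dsimp only at *; omega) | rfl
  · exact h

theorem exists_gridBoundary_ne_zero {g : ℤ × ℤ → ZMod 2} (hfin : (Function.support g).Finite)
    {s : ℤ × ℤ} (hs : g s ≠ 0) : ∃ p q, gridBoundary g p q ≠ 0 := by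
  by_contra! hcon
  have h : ∀ m : ℕ, g (s.1 + m, s.2) ≠ 0 := fun m => by
    induction m with
    | zero => simpa using hs
    | succ m ih =>
      intro h0
      have := hcon (s.1 + (m + 1 : ℕ), s.2) (s.1 + (m + 1 : ℕ), s.2 + 1)
      simp only [gridBoundary, h0] at this
      apply ih
      rw [if_neg (by omega), if_neg (by omega), if_pos (by simp), zero_add] at this
      rw [← this]
      push_cast
      congr 2
      ring
  refine Set.infinite_of_injective_forall_mem (f := fun m : ℕ => ((s.1 + m, s.2) : ℤ × ℤ)) ?_ h hfin
  intro a b hab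
  simpa using hab

theorem finite_setOf_gridBoundary_ne_zero {g : ℤ × ℤ → ZMod 2}
    (hfin : (Function.support g).Finite) :
    {e : (ℤ × ℤ) × (ℤ × ℤ) | gridBoundary g e.1 e.2 ≠ 0}.Finite := by
  let T : Set (ℤ × ℤ) := ⋃ s ∈ Function.support g, Icc (s.1 - 1, s.2 - 1) (s.1 + 1, s.2 + 1)
  have hT : T.Finite := hfin.biUnion fun s _ => Set.finite_Icc _ _
  have hmem : ∀ s v : ℤ × ℤ, g s ≠ 0 → s.1 - 1 ≤ v.1 → s.2 - 1 ≤ v.2 → v.1 ≤ s.1 + 1 →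
      v.2 ≤ s.2 + 1 → v ∈ T := fun s v hs h1 h2 h3 h4 =>
    mem_biUnion (show s ∈ Function.support g from hs) ⟨⟨h1, h2⟩, ⟨h3, h4⟩⟩
  have hor : ∀ s t : ℤ × ℤ, g s + g t ≠ 0 → g s ≠ 0 ∨ g t ≠ 0 := fun s t h => by
    by_contra! h'
    simp [h'] at h
  refine (hT.prod hT).subset ?_
  rintro ⟨p, q⟩ h
  simp only [mem_ofPred_eq, gridBoundary] at h
  split_ifs at h
  all_goals first
    | exact absurd rfl h
    | rcases hor _ _ h with h | h <;> constructor <;>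
        refine hmem _ _ h ?_ ?_ ?_ ?_ <;> dsimp only <;> omega

/-- A square of a finite mod 2 chain of unit squares is enclosed by a simple cycle contained in the
boundary of the chain. -/
theorem exists_simple_cycle_around (s : ℤ × ℤ) {g : ℤ × ℤ → ZMod 2}
    (hfin : (Function.support g).Finite) (hs : g s ≠ 0) :
    ∃ (n : ℕ) (c : ℕ → ℤ × ℤ), 3 ≤ n ∧ c n = c 0 ∧ InjOn c (Iio n) ∧
      (∀ k < n, gridBoundary g (c k) (c (k + 1)) ≠ 0) ∧ crossingParity c n s ≠ 0 := by
  induction hm : {e : (ℤ × ℤ) × (ℤ × ℤ) | gridBoundary g e.1 e.2 ≠ 0}.ncard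
    using Nat.strong_induction_on generalizing g with
  | _ m ih =>
    have hEfin := finite_setOf_gridBoundary_ne_zero hfin
    obtain ⟨n, c, hn, hc, hinj, hbd⟩ := exists_simple_cycle
      (r := fun p q => gridBoundary g p q ≠ 0)
      (fun p h => by
        have := isGridStep_of_gridBoundary_ne_zero h
        unfold IsGridStep at this
        omega)
      ((hEfin.image Prod.fst).subset (by
        rintro p ⟨q, h⟩
        exact ⟨(p, q), h, rfl⟩))
      (fun p q h => exists_gridBoundary_ne_zero_of_ne h) (exists_gridBoundary_ne_zero hfin hs)
    have hstep : ∀ k < n, IsGridStep (c k) (c (k + 1)) := fun k hk =>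
      isGridStep_of_gridBoundary_ne_zero (hbd k hk)
    by_cases hcs : crossingParity c n s ≠ 0
    · exact ⟨n, c, hn, hc, hinj, hbd, hcs⟩
    push Not at hcs
    have two : ∀ a b : ZMod 2, a ≠ 0 → b ≠ 0 → a + b = 0 := by decide
    have hle : ∀ p q, gridBoundary (crossingParity c n) p q ≠ 0 → gridBoundary g p q ≠ 0 := by
      intro p q h
      obtain ⟨k, hk, ⟨rfl, rfl⟩ | ⟨rfl, rfl⟩⟩ :=
        exists_step_of_gridBoundary_crossingParity_ne_zero hc hstep h
      · exact hbd k hk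
      · rw [gridBoundary_symm]
        exact hbd k hk
    have hsub : ∀ p q, gridBoundary (g + crossingParity c n) p q ≠ 0 →
        gridBoundary g p q ≠ 0 := by
      intro p q h h0
      rw [gridBoundary_add, h0, zero_add] at h
      exact hle p q h h0
    have hlt : {e : (ℤ × ℤ) × (ℤ × ℤ) |
        gridBoundary (g + crossingParity c n) e.1 e.2 ≠ 0}.ncard < m := by
      rw [← hm]
      refine Set.ncard_lt_ncard ⟨fun e he => hsub _ _ he, fun hcon => ?_⟩ hEfin
      have h01 := gridBoundary_crossingParity_zero_one_ne_zero hn hc hinj hstep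
      refine hcon (show (c 0, c 1) ∈ _ from hbd 0 (by omega)) ?_
      rw [gridBoundary_add]
      exact two _ _ (hbd 0 (by omega)) h01
    obtain ⟨n', c', hn', hc', hinj', hbd', hcross⟩ := ih _ hlt
      ((hfin.union (finite_support_crossingParity hc hstep)).subset (Function.support_add _ _))
      (by simpa [hcs] using hs) rfl
    exact ⟨n', c', hn', hc', hinj', fun k hk => hsub _ _ (hbd' k hk), hcross⟩

/-- The point at parameter `t` of the segment joining two lattice points. -/
def edgePoint (p q : ℤ × ℤ) (t : ℝ) : ℂ :=
  ⟨p.1 + t * (q.1 - p.1), p.2 + t * (q.2 - p.2)⟩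

theorem edgePoint_swap (p q : ℤ × ℤ) (t : ℝ) : edgePoint p q t = edgePoint q p (1 - t) := by
  unfold edgePoint
  congr 1 <;> ring

/-- The closed unit square with lower left corner `s`. -/
def gridSquare (s : ℤ × ℤ) : Set ℂ :=
  {z | (s.1 : ℝ) ≤ z.re ∧ z.re ≤ s.1 + 1 ∧ (s.2 : ℝ) ≤ z.im ∧ z.im ≤ s.2 + 1}

theorem mem_gridSquare_floor (z : ℂ) : z ∈ gridSquare (⌊z.re⌋, ⌊z.im⌋) :=
  ⟨Int.floor_le _, (Int.lt_floor_add_one _).le, Int.floor_le _, (Int.lt_floor_add_one _).le⟩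

theorem dist_le_two_of_mem_gridSquare {s : ℤ × ℤ} {z w : ℂ} (hz : z ∈ gridSquare s)
    (hw : w ∈ gridSquare s) : dist z w ≤ 2 := by
  obtain ⟨h1, h2, h3, h4⟩ := hz
  obtain ⟨k1, k2, k3, k4⟩ := hw
  rw [dist_eq_norm]
  refine (Complex.norm_le_abs_re_add_abs_im _).trans ?_
  have h5 : |(z - w).re| ≤ 1 := by rw [Complex.sub_re, abs_le]; constructor <;> linarith
  have h6 : |(z - w).im| ≤ 1 := by rw [Complex.sub_im, abs_le]; constructor <;> linarith
  linarith

theorem exists_adjacent_squares {g : ℤ × ℤ → ZMod 2} {p q : ℤ × ℤ}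
    (h : gridBoundary g p q ≠ 0) : ∃ s s', g s ≠ g s' ∧
      ∀ t ∈ Icc (0 : ℝ) 1, edgePoint p q t ∈ gridSquare s ∧ edgePoint p q t ∈ gridSquare s' := by
  have hadd : ∀ a b : ZMod 2, a + b ≠ 0 → a ≠ b := by decide
  wlog hpq : (q.1 = p.1 + 1 ∧ q.2 = p.2) ∨ (q.1 = p.1 ∧ q.2 = p.2 + 1) generalizing p q
  · have hstep := isGridStep_of_gridBoundary_ne_zero h
    obtain ⟨s, s', hs, hmem⟩ := this (p := q) (q := p) (by rwa [gridBoundary_symm])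
      (by unfold IsGridStep at *; omega)
    refine ⟨s, s', hs, fun t ht => ?_⟩
    rw [edgePoint_swap]
    exact hmem _ ⟨by linarith [ht.2], by linarith [ht.1]⟩
  obtain ⟨a, b⟩ := p
  obtain ⟨a', b'⟩ := q
  simp only at hpq
  rcases hpq with ⟨rfl, rfl⟩ | ⟨rfl, rfl⟩
  · rw [gridBoundary, if_pos (by simp)] at h
    refine ⟨_, _, hadd _ _ h, fun t ht => ?_⟩
    obtain ⟨h0, h1⟩ := ht
    simp only [edgePoint, gridSquare, mem_ofPred_eq]
    push_cast
    refine ⟨⟨?_, ?_, ?_, ?_⟩, ?_, ?_, ?_, ?_⟩ <;> linarith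
  · rw [gridBoundary, if_neg (by simp), if_neg (by simp), if_pos (by simp)] at h
    refine ⟨_, _, hadd _ _ h, fun t ht => ?_⟩
    obtain ⟨h0, h1⟩ := ht
    simp only [edgePoint, gridSquare, mem_ofPred_eq]
    push_cast
    refine ⟨⟨?_, ?_, ?_, ?_⟩, ?_, ?_, ?_, ?_⟩ <;> linarith

/-- The union of the unit squares in the support of a mod 2 chain. -/
def chainSupport (g : ℤ × ℤ → ZMod 2) : Set ℂ :=
  ⋃ s ∈ Function.support g, gridSquare s

theorem isBounded_chainSupport {g : ℤ × ℤ → ZMod 2} (hfin : (Function.support g).Finite) :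
    Bornology.IsBounded (chainSupport g) := by
  refine (Bornology.isBounded_biUnion hfin).2 fun s _ => ?_
  rw [Metric.isBounded_iff]
  exact ⟨2, fun z hz w hw => dist_le_two_of_mem_gridSquare hz hw⟩

theorem coeff_eq_of_mem_gridSquare {g : ℤ × ℤ → ZMod 2} {z : ℂ}
    (hz : ∀ p q, gridBoundary g p q ≠ 0 → ∀ t ∈ Icc (0 : ℝ) 1, edgePoint p q t ≠ z)
    {s s' : ℤ × ℤ} (hs : z ∈ gridSquare s) (hs' : z ∈ gridSquare s') : g s = g s' := by
  have hadd : ∀ a b : ZMod 2, a + b = 0 → b = a := by decide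
  have horiz : ∀ i j : ℤ, z ∈ gridSquare (i, j) → z ∈ gridSquare (i + 1, j) →
      g (i, j) = g (i + 1, j) := by
    rintro i j ⟨h1, h2, h3, h4⟩ ⟨h5, h6, h7, h8⟩
    push_cast at *
    by_contra hne
    refine hz (i + 1, j) (i + 1, j + 1) ?_ (z.im - j) ⟨by linarith, by linarith⟩ ?_
    · rw [gridBoundary, if_neg (by simp), if_neg (by simp), if_pos (by simp)]
      intro h0
      apply hne
      simpa using hadd _ _ h0
    · apply Complex.ext
      · simp [edgePoint]
        linarith
      · simp [edgePoint]
  have vert : ∀ i j : ℤ, z ∈ gridSquare (i, j) → z ∈ gridSquare (i, j + 1) →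
      g (i, j) = g (i, j + 1) := by
    rintro i j ⟨h1, h2, h3, h4⟩ ⟨h5, h6, h7, h8⟩
    push_cast at *
    by_contra hne
    refine hz (i, j + 1) (i + 1, j + 1) ?_ (z.re - i) ⟨by linarith, by linarith⟩ ?_
    · rw [gridBoundary, if_pos (by simp)]
      intro h0
      apply hne
      simpa using hadd _ _ h0
    · apply Complex.ext
      · simp [edgePoint]
      · simp [edgePoint]
        linarith
  obtain ⟨i, j⟩ := s
  obtain ⟨i', j'⟩ := s'
  have hmid : z ∈ gridSquare (i', j) := ⟨hs'.1, hs'.2.1, hs.2.2.1, hs.2.2.2⟩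
  have close : ∀ (a b : ℤ) (u : ℝ), (a : ℝ) ≤ u → u ≤ a + 1 → (b : ℝ) ≤ u → u ≤ b + 1 →
      b = a ∨ b = a + 1 ∨ a = b + 1 := fun a b u h1 h2 h3 h4 => by
    have h5 : (a : ℝ) ≤ b + 1 := h1.trans h4
    have h6 : (b : ℝ) ≤ a + 1 := h3.trans h2
    norm_cast at h5 h6
    omega
  have e1 : g (i, j) = g (i', j) := by
    rcases close i i' _ hs.1 hs.2.1 hs'.1 hs'.2.1 with rfl | rfl | rfl
    · rfl
    · exact horiz _ _ hs hmid
    · exact (horiz _ _ hmid hs).symm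
  have e2 : g (i', j) = g (i', j') := by
    rcases close j j' _ hs.2.2.1 hs.2.2.2 hs'.2.2.1 hs'.2.2.2 with rfl | rfl | rfl
    · rfl
    · exact vert _ _ hmid hs'
    · exact (vert _ _ hs' hmid).symm
  exact e1.trans e2

theorem eventually_gridSquare_subset (z : ℂ) :
    ∀ᶠ w in nhds z, ∀ s, w ∈ gridSquare s → z ∈ gridSquare s := by
  have hre : Filter.Tendsto Complex.re (nhds z) (nhds z.re) := Complex.continuous_re.continuousAt
  have him : Filter.Tendsto Complex.im (nhds z) (nhds z.im) := Complex.continuous_im.continuousAt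
  have near : ∀ (a b : ℝ) (i : ℤ), (⌈a⌉ : ℝ) - 1 < b → b < ⌊a⌋ + 1 → (i : ℝ) ≤ b → b ≤ i + 1 →
      (i : ℝ) ≤ a ∧ a ≤ i + 1 := fun a b i h1 h2 h3 h4 => by
    have h5 : (i : ℝ) < ⌊a⌋ + 1 := h3.trans_lt h2
    have h6 : (⌈a⌉ : ℝ) - 1 < i + 1 := h1.trans_le h4
    norm_cast at h5 h6
    refine ⟨Int.le_floor.1 (by omega), ?_⟩
    have : ⌈a⌉ ≤ i + 1 := by omega
    exact_mod_cast Int.ceil_le.1 this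
  filter_upwards [hre.eventually (lt_mem_nhds (sub_lt_iff_lt_add.2 (Int.ceil_lt_add_one z.re))),
    hre.eventually (gt_mem_nhds (Int.lt_floor_add_one z.re)),
    him.eventually (lt_mem_nhds (sub_lt_iff_lt_add.2 (Int.ceil_lt_add_one z.im))),
    him.eventually (gt_mem_nhds (Int.lt_floor_add_one z.im))]
    with w h1 h2 h3 h4 s hs
  obtain ⟨k1, k2, k3, k4⟩ := hs
  exact ⟨(near _ _ _ h1 h2 k1 k2).1, (near _ _ _ h1 h2 k1 k2).2,
    (near _ _ _ h3 h4 k3 k4).1, (near _ _ _ h3 h4 k3 k4).2⟩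

theorem exists_edgePoint_of_mem_frontier_chainSupport {g : ℤ × ℤ → ZMod 2} {z : ℂ}
    (hz : z ∈ frontier (chainSupport g)) :
    ∃ p q, gridBoundary g p q ≠ 0 ∧ ∃ t ∈ Icc (0 : ℝ) 1, edgePoint p q t = z := by
  by_contra! hcon
  have hsame : ∀ s s', z ∈ gridSquare s → z ∈ gridSquare s' → g s = g s' := fun s s' =>
    coeff_eq_of_mem_gridSquare hcon
  have hnear := eventually_gridSquare_subset z
  by_cases hzs : g (⌊z.re⌋, ⌊z.im⌋) = 0
  · have hev : (chainSupport g)ᶜ ∈ nhds z := by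
      filter_upwards [hnear] with w hw hmem
      obtain ⟨s, hs, hws⟩ := mem_iUnion₂.1 hmem
      exact hs ((hsame _ _ (hw s hws) (mem_gridSquare_floor z)).trans hzs)
    rw [← frontier_compl] at hz
    exact hz.2 (mem_interior_iff_mem_nhds.2 hev)
  · refine hz.2 (mem_interior_iff_mem_nhds.2 ?_)
    filter_upwards [hnear] with w hw
    refine mem_iUnion₂.2 ⟨(⌊w.re⌋, ⌊w.im⌋), ?_, mem_gridSquare_floor w⟩
    rw [Function.mem_support, hsame _ _ (hw _ (mem_gridSquare_floor w)) (mem_gridSquare_floor z)]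
    exact hzs

/-- The point at parameter `u ∈ [0, n]` of the polygonal path through `c 0, …, c n`. -/
noncomputable def polyline (c : ℕ → ℤ × ℤ) (n : ℕ) (u : ℝ) : ℂ :=
  edgePoint (c 0) (c 0) 0 + ∑ k ∈ Finset.range n,
    ((max 0 (min 1 (u - k)) : ℝ) : ℂ) * (edgePoint (c k) (c (k + 1)) 1 -
      edgePoint (c k) (c (k + 1)) 0)

theorem continuous_polyline (c : ℕ → ℤ × ℤ) (n : ℕ) : Continuous (polyline c n) := by
  unfold polyline
  fun_prop

theorem polyline_of_le {c : ℕ → ℤ × ℤ} {n : ℕ} {u : ℝ} (hu : n ≤ u) :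
    polyline c n u = edgePoint (c n) (c n) 0 := by
  induction n with
  | zero => simp [polyline]
  | succ n ih =>
    push_cast at hu
    have h := ih (by linarith)
    unfold polyline at h ⊢
    rw [Finset.sum_range_succ, ← add_assoc, h, min_eq_left (by linarith), max_eq_right zero_le_one]
    apply Complex.ext <;> simp [edgePoint]

theorem polyline_eq_edgePoint {c : ℕ → ℤ × ℤ} {n k : ℕ} (hk : k < n) {u : ℝ} (h0 : k ≤ u)
    (h1 : u ≤ k + 1) : polyline c n u = edgePoint (c k) (c (k + 1)) (u - k) := by
  induction n with
  | zero => omega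
  | succ n ih =>
    rcases Nat.lt_succ_iff_lt_or_eq.1 hk with h | rfl
    · rw [← ih h]
      have : (k : ℝ) + 1 ≤ n := by exact_mod_cast h
      unfold polyline
      rw [Finset.sum_range_succ, max_eq_left (min_le_of_right_le (by linarith))]
      simp
    · have h := polyline_of_le (c := c) h0
      unfold polyline at h ⊢
      rw [Finset.sum_range_succ, ← add_assoc, h, min_eq_right (by linarith),
        max_eq_right (by linarith)]
      apply Complex.ext <;> simp [edgePoint]

theorem eq_or_swap_of_edgePoint_eq {p q p' q' : ℤ × ℤ} (h : IsGridStep p q)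
    (h' : IsGridStep p' q') {t t' : ℝ} (ht : t ∈ Ico (0 : ℝ) 1) (ht' : t' ∈ Ico (0 : ℝ) 1)
    (heq : edgePoint p q t = edgePoint p' q' t') : p = p' ∨ (p = q' ∧ q = p') := by
  obtain ⟨a, b⟩ := p
  obtain ⟨x, y⟩ := q
  obtain ⟨a', b'⟩ := p'
  obtain ⟨x', y'⟩ := q'
  obtain ⟨t0, t1⟩ := ht
  obtain ⟨s0, s1⟩ := ht'
  have hre := congrArg Complex.re heq
  have him := congrArg Complex.im heq
  simp only [edgePoint] at hre him
  simp only [IsGridStep] at h h'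
  simp only [Prod.mk.injEq]
  have hA : a = a' ∨ a = a' + 1 ∨ a' = a + 1 := by
    have h1 : (a : ℝ) < a' + 2 ∧ (a' : ℝ) < a + 2 := by
      rcases h with ⟨rfl, rfl⟩ | ⟨rfl, rfl⟩ | ⟨rfl, rfl⟩ | ⟨rfl, rfl⟩ <;>
      rcases h' with ⟨rfl, rfl⟩ | ⟨rfl, rfl⟩ | ⟨rfl, rfl⟩ | ⟨rfl, rfl⟩ <;>
      push_cast at hre him ⊢ <;> constructor <;> linarith
    norm_cast at h1
    omega
  have hB : b = b' ∨ b = b' + 1 ∨ b' = b + 1 := by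
    have h1 : (b : ℝ) < b' + 2 ∧ (b' : ℝ) < b + 2 := by
      rcases h with ⟨rfl, rfl⟩ | ⟨rfl, rfl⟩ | ⟨rfl, rfl⟩ | ⟨rfl, rfl⟩ <;>
      rcases h' with ⟨rfl, rfl⟩ | ⟨rfl, rfl⟩ | ⟨rfl, rfl⟩ | ⟨rfl, rfl⟩ <;>
      push_cast at hre him ⊢ <;> constructor <;> linarith
    norm_cast at h1
    omega
  by_contra hcon
  rcases h with ⟨rfl, rfl⟩ | ⟨rfl, rfl⟩ | ⟨rfl, rfl⟩ | ⟨rfl, rfl⟩ <;>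
  rcases h' with ⟨rfl, rfl⟩ | ⟨rfl, rfl⟩ | ⟨rfl, rfl⟩ | ⟨rfl, rfl⟩ <;>
  rcases hA with hA | hA | hA <;> rcases hB with hB | hB | hB <;>
  first
  | omega
  | (exfalso
     have hA' := congrArg (Int.cast : ℤ → ℝ) hA
     have hB' := congrArg (Int.cast : ℤ → ℝ) hB
     push_cast at hre him hA' hB'
     linarith)

theorem injOn_polyline {c : ℕ → ℤ × ℤ} {n : ℕ} (hn : 3 ≤ n) (hc : c n = c 0)
    (hinj : InjOn c (Iio n)) (hstep : ∀ k < n, IsGridStep (c k) (c (k + 1))) :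
    InjOn (polyline c n) (Ico 0 n) := by
  intro u hu v hv huv
  have hk : ⌊u⌋₊ < n := (Nat.floor_lt hu.1).2 hu.2
  have hl : ⌊v⌋₊ < n := (Nat.floor_lt hv.1).2 hv.2
  have hu0 := Nat.floor_le hu.1
  have hu1 := Nat.lt_floor_add_one u
  have hv0 := Nat.floor_le hv.1
  have hv1 := Nat.lt_floor_add_one v
  generalize ⌊u⌋₊ = k at *
  generalize ⌊v⌋₊ = l at *
  rw [polyline_eq_edgePoint hk hu0 hu1.le, polyline_eq_edgePoint hl hv0 hv1.le] at huv
  rcases eq_or_swap_of_edgePoint_eq (hstep k hk) (hstep l hl)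
    ⟨by linarith, by linarith⟩ ⟨by linarith, by linarith⟩ huv with h | ⟨h, hswap⟩
  · have hkl : k = l := hinj hk hl h
    subst hkl
    have hre := congrArg Complex.re huv
    have him := congrArg Complex.im huv
    simp only [edgePoint] at hre him
    rcases hstep k hk with ⟨e1, e2⟩ | ⟨e1, e2⟩ | ⟨e1, e2⟩ | ⟨e1, e2⟩ <;>
    simp only [e1, e2] at hre him <;> push_cast at hre him <;> linarith
  · exfalso
    rcases Nat.lt_or_ge (l + 1) n with hl' | hl'
    · have : k = l + 1 := hinj hk hl' h
      subst this
      rcases Nat.lt_or_ge (l + 1 + 1) n with hl'' | hl''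
      · have := hinj hl'' hl hswap
        omega
      · rw [show l + 1 + 1 = n by omega, hc] at hswap
        have := hinj (show 0 < n by omega) hl hswap
        omega
    · rw [show l + 1 = n by omega, hc] at h
      have : k = 0 := hinj hk (show 0 < n by omega) h
      subst this
      have := hinj (show 0 + 1 < n by omega) hl hswap
      omega

/-- A simple closed grid path is traced by a Jordan loop. -/
theorem exists_jordanLoop_of_simple_cycle {c : ℕ → ℤ × ℤ} {n : ℕ} (hn : 3 ≤ n) (hc : c n = c 0)
    (hinj : InjOn c (Iio n)) (hstep : ∀ k < n, IsGridStep (c k) (c (k + 1))) :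
    ∃ γ : ℝ → ℂ, JordanLoop γ ∧
      ∀ z, z ∈ range γ ↔ ∃ k < n, ∃ t ∈ Icc (0 : ℝ) 1, edgePoint (c k) (c (k + 1)) t = z := by
  have hn0 : (0 : ℝ) < n := by exact_mod_cast (by omega : 0 < n)
  have hends : polyline c n (n * 0) = polyline c n (n * 1) := by
    rw [mul_one, polyline_of_le le_rfl, hc,
      polyline_eq_edgePoint (k := 0) (by omega) (by simp) (by simp)]
    simp [edgePoint]
  refine ⟨fun t => polyline c n (n * Int.fract t), ⟨?_, ?_, ?_⟩, fun z => ⟨?_, ?_⟩⟩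
  · exact ContinuousOn.comp_fract'' (f := fun t => polyline c n (n * t))
      ((continuous_polyline c n).comp (by fun_prop)).continuousOn hends
  · intro t
    simp
  · intro t ht s hs hts
    have hmem : ∀ r ∈ Ico (0 : ℝ) 1, (n : ℝ) * r ∈ Ico (0 : ℝ) n := fun r hr =>
      ⟨mul_nonneg hn0.le hr.1, by nlinarith [hr.2]⟩
    simp only [Int.fract_eq_self.2 ht, Int.fract_eq_self.2 hs] at hts
    exact mul_left_cancel₀ hn0.ne'
      (injOn_polyline hn hc hinj hstep (hmem t ht) (hmem s hs) hts)
  · rintro ⟨t, rfl⟩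
    have h0 : 0 ≤ (n : ℝ) * Int.fract t := mul_nonneg hn0.le (Int.fract_nonneg t)
    have h1 : (n : ℝ) * Int.fract t < n := by nlinarith [Int.fract_lt_one t]
    have hk := (Nat.floor_lt h0).2 h1
    have hk0 := Nat.floor_le h0
    have hk1 := Nat.lt_floor_add_one ((n : ℝ) * Int.fract t)
    exact ⟨_, hk, _, ⟨by linarith, by linarith⟩, (polyline_eq_edgePoint hk hk0 hk1.le).symm⟩
  · rintro ⟨k, hk, t, ht, rfl⟩
    have hpt := polyline_eq_edgePoint (c := c) hk (u := k + t) (by linarith [ht.1])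
      (by linarith [ht.2])
    rw [add_sub_cancel_left] at hpt
    rw [← hpt]
    have hkn : (k : ℝ) + 1 ≤ n := by exact_mod_cast hk
    rcases lt_or_eq_of_le (show (k : ℝ) + t ≤ n by linarith [ht.2]) with h | h
    · refine ⟨(k + t) / n, ?_⟩
      have : Int.fract (((k : ℝ) + t) / n) = (k + t) / n :=
        Int.fract_eq_self.2 ⟨div_nonneg (by linarith [ht.1, Nat.cast_nonneg (α := ℝ) k]) hn0.le,
          (div_lt_one hn0).2 h⟩
      simp only [this, mul_div_cancel₀ _ hn0.ne']
    · refine ⟨0, ?_⟩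
      simp only [Int.fract_zero]
      rw [h, hends, mul_one]

/-- A point of a compact set is enclosed by a Jordan loop that misses the set and stays at distance
at most two from it; the loop contains the frontier of the enclosed region. -/
theorem exists_jordanLoop_near {K : Set ℂ} (hK : IsCompact K) {x : ℂ} (hx : x ∈ K) :
    ∃ (γ : ℝ → ℂ) (B : Set ℂ), JordanLoop γ ∧ (∀ z ∈ range γ, z ∉ K ∧ ∃ w ∈ K, dist z w ≤ 2) ∧
      Bornology.IsBounded B ∧ x ∈ B ∧ frontier B ⊆ range γ := by
  classical
  let g : ℤ × ℤ → ZMod 2 := fun s => if (gridSquare s ∩ K).Nonempty then 1 else 0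
  have hg : ∀ s, g s ≠ 0 ↔ (gridSquare s ∩ K).Nonempty := fun s => by simp [g]
  have hfin : (Function.support g).Finite := by
    obtain ⟨R, hR⟩ := hK.isBounded.exists_norm_le
    refine (Set.finite_Icc (-⌈R⌉ - 1, -⌈R⌉ - 1) (⌈R⌉, ⌈R⌉)).subset ?_
    rintro ⟨i, j⟩ hs
    obtain ⟨z, ⟨h1, h2, h3, h4⟩, hz⟩ := (hg _).1 hs
    have hz' := hR z hz
    have hre := abs_le.1 ((Complex.abs_re_le_norm z).trans (hz'.trans (Int.le_ceil R)))
    have him := abs_le.1 ((Complex.abs_im_le_norm z).trans (hz'.trans (Int.le_ceil R)))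
    have k1 : (i : ℝ) ≤ ⌈R⌉ := h1.trans hre.2
    have k2 : (j : ℝ) ≤ ⌈R⌉ := h3.trans him.2
    have k3 : -(⌈R⌉ : ℝ) ≤ i + 1 := hre.1.trans h2
    have k4 : -(⌈R⌉ : ℝ) ≤ j + 1 := him.1.trans h4
    norm_cast at k1 k2 k3 k4
    refine ⟨⟨?_, ?_⟩, ⟨k1, k2⟩⟩ <;> dsimp only <;> omega
  obtain ⟨n, c, hn, hc, hinj, hbd, hcs⟩ := exists_simple_cycle_around _ hfin
    ((hg (⌊x.re⌋, ⌊x.im⌋)).2 ⟨x, mem_gridSquare_floor x, hx⟩)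
  have hstep : ∀ k < n, IsGridStep (c k) (c (k + 1)) := fun k hk =>
    isGridStep_of_gridBoundary_ne_zero (hbd k hk)
  obtain ⟨γ, hγ, hrange⟩ := exists_jordanLoop_of_simple_cycle hn hc hinj hstep
  refine ⟨γ, chainSupport (crossingParity c n), hγ, fun z hz => ?_,
    isBounded_chainSupport (finite_support_crossingParity hc hstep),
    mem_iUnion₂.2 ⟨_, hcs, mem_gridSquare_floor x⟩, fun z hz => ?_⟩
  · obtain ⟨k, hk, t, ht, rfl⟩ := (hrange z).1 hz
    obtain ⟨s, s', hss, hmem⟩ := exists_adjacent_squares (hbd k hk)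
    obtain ⟨hm, hm'⟩ := hmem t ht
    constructor
    · intro hzK
      have h1 : (gridSquare s ∩ K).Nonempty := ⟨_, hm, hzK⟩
      have h2 : (gridSquare s' ∩ K).Nonempty := ⟨_, hm', hzK⟩
      simp [g, h1, h2] at hss
    · have : g s ≠ 0 ∨ g s' ≠ 0 := by
        by_contra! h
        exact hss (h.1.trans h.2.symm)
      rcases this with h | h
      · obtain ⟨w, hw, hwK⟩ := (hg _).1 h
        exact ⟨w, hwK, dist_le_two_of_mem_gridSquare hm hw⟩
      · obtain ⟨w, hw, hwK⟩ := (hg _).1 h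
        exact ⟨w, hwK, dist_le_two_of_mem_gridSquare hm' hw⟩
  · obtain ⟨p, q, hpq, t, ht, rfl⟩ := exists_edgePoint_of_mem_frontier_chainSupport hz
    obtain ⟨k, hk, ⟨rfl, rfl⟩ | ⟨rfl, rfl⟩⟩ :=
      exists_step_of_gridBoundary_crossingParity_ne_zero hc hstep hpq
    · exact (hrange _).2 ⟨k, hk, t, ht, rfl⟩
    · rw [edgePoint_swap]
      exact (hrange _).2 ⟨k, hk, 1 - t, ⟨by linarith [ht.2], by linarith [ht.1]⟩, rfl⟩

theorem mem_topHull_of_frontier_subset {S B : Set ℂ} (hB : Bornology.IsBounded B)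
    (hS : frontier B ⊆ S) {x : ℂ} (hx : x ∈ B) : x ∈ topHull S := by
  by_cases hxS : x ∈ S
  · exact Or.inl hxS
  refine Or.inr ⟨hxS, hB.subset ?_⟩
  have hpre : IsPreconnected (connectedComponentIn Sᶜ x) := isPreconnected_connectedComponentIn
  have hdisj : connectedComponentIn Sᶜ x ∩ frontier B = ∅ := by
    rw [← disjoint_iff_inter_eq_empty]
    exact Set.disjoint_left.2 fun z hz hzB => connectedComponentIn_subset _ _ hz (hS hzB)
  have hxint : x ∈ interior B := by
    by_contra h
    exact hxS (hS ⟨subset_closure hx, h⟩)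
  refine Subset.trans (hpre.subset_left_of_subset_union isOpen_interior
    (isClosed_closure (s := B)).isOpen_compl ?_ ?_ ?_) interior_subset
  · exact Set.disjoint_left.2 fun z hz hz' => hz' (subset_closure (interior_subset hz))
  · intro z hz
    by_contra h
    rw [mem_union, not_or, mem_compl_iff, not_not] at h
    exact (hdisj ▸ (⟨hz, h.2, h.1⟩ : z ∈ connectedComponentIn Sᶜ x ∩ frontier B) : z ∈ (∅ : Set ℂ))
  · exact ⟨x, mem_connectedComponentIn hxS, hxint⟩

/-- A point of a compact set is enclosed by a Jordan loop that misses the set and is contained in a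
prescribed neighbourhood of it. -/
theorem exists_jordanLoop_subset {K W : Set ℂ} (hK : IsCompact K) (hW : IsOpen W) (hKW : K ⊆ W)
    {x : ℂ} (hx : x ∈ K) :
    ∃ γ : ℝ → ℂ, JordanLoop γ ∧ range γ ⊆ W \ K ∧ x ∈ topHull (range γ) := by
  obtain ⟨δ, hδ, hsub⟩ := hK.exists_cthickening_subset_open hW hKW
  have hr : (δ / 2 : ℂ) ≠ 0 := by
    have : (δ : ℂ) ≠ 0 := by exact_mod_cast hδ.ne'
    simp [this]
  let h : ℂ ≃ₜ ℂ := Homeomorph.mulLeft₀ (δ / 2 : ℂ) hr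
  obtain ⟨γ, B, ⟨hγc, hγp, hγi⟩, hnear, hB, hxB, hfr⟩ :=
    exists_jordanLoop_near (hK.image h.symm.continuous) (mem_image_of_mem _ hx)
  refine ⟨h ∘ γ, ⟨h.continuous.comp hγc, fun t => by simp [hγp t], h.injective.injOn.comp hγi
    (mapsTo_univ _ _)⟩, ?_, ?_⟩
  · rintro _ ⟨t, rfl⟩
    obtain ⟨hout, w, ⟨v, hv, rfl⟩, hd⟩ := hnear _ (mem_range_self t)
    refine ⟨hsub (Metric.mem_cthickening_of_dist_le _ v _ _ hv ?_), fun hmem => hout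
      ⟨_, hmem, h.symm_apply_apply _⟩⟩
    have hv' : v = h (h.symm v) := (h.apply_symm_apply v).symm
    rw [hv']
    generalize h.symm v = v' at hd
    simp only [h, Function.comp_apply, Homeomorph.coe_mulLeft₀, dist_eq_norm, ← mul_sub,
      norm_mul] at hd ⊢
    rw [norm_div, Complex.norm_real, Real.norm_of_nonneg hδ.le, Complex.norm_ofNat]
    nlinarith
  · refine mem_topHull_of_frontier_subset (B := h '' B) ?_ ?_ ⟨_, hxB, h.apply_symm_apply x⟩
    · exact (hB.isCompact_closure.image h.continuous).isBounded.subset (image_mono subset_closure)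
    · rw [← h.image_frontier, range_comp]
      exact image_mono hfr

/-- A component of a compact set has arbitrarily small relatively clopen neighbourhoods. -/
theorem exists_isCompact_split {X : Type*} [TopologicalSpace X] [T2Space X] {L V : Set X}
    (hL : IsCompact L) (hV : IsOpen V) {x : X} (hx : x ∈ L)
    (hCV : connectedComponentIn L x ⊆ V) :
    ∃ L' ⊆ L, IsCompact L' ∧ IsCompact (L \ L') ∧ x ∈ L' ∧ L' ⊆ V := by
  have : CompactSpace L := isCompact_iff_compactSpace.1 hL
  let x' : L := ⟨x, hx⟩
  have : Nonempty {s : Set L // IsClopen s ∧ x' ∈ s} := ⟨⟨univ, isClopen_univ, mem_univ _⟩⟩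
  obtain ⟨⟨s, hs, hxs⟩, hsV⟩ := exists_subset_nhds_of_isCompact
    (V := fun s : {s : Set L // IsClopen s ∧ x' ∈ s} => (s : Set L))
    (U := Subtype.val ⁻¹' V)
    (fun s t => ⟨⟨s.1 ∩ t.1, s.2.1.inter t.2.1, s.2.2, t.2.2⟩, inter_subset_left,
      inter_subset_right⟩)
    (fun s => s.2.1.isClosed.isCompact) (by
      intro y hy
      rw [← connectedComponent_eq_iInter_isClopen] at hy
      refine (hV.preimage continuous_subtype_val).mem_nhds (hCV ?_)
      rw [connectedComponentIn_eq_image hx]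
      exact mem_image_of_mem _ hy)
  refine ⟨Subtype.val '' s, ?_, hs.isClosed.isCompact.image continuous_subtype_val, ?_,
    ⟨x', hxs, rfl⟩, image_subset_iff.2 hsV⟩
  · rintro _ ⟨y, -, rfl⟩
    exact y.2
  · have : L \ Subtype.val '' s = Subtype.val '' sᶜ := by
      rw [image_compl_eq_range_sdiff_image Subtype.val_injective, Subtype.range_coe]
    rw [this]
    exact hs.compl.isClosed.isCompact.image continuous_subtype_val

theorem not_isBounded_halfSpace {ψ : ℂ →L[ℝ] ℝ} {v : ℂ} (hv : 0 < ψ v) (r : ℝ) :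
    ¬ Bornology.IsBounded {w | r ≤ ψ w} := by
  intro hb
  obtain ⟨R, hR⟩ := (hb.image ψ).bddAbove
  have hmem : ((|r| + |R| + 1) / ψ v) • v ∈ {w | r ≤ ψ w} := by
    rw [mem_ofPred_eq, map_smul, smul_eq_mul, div_mul_cancel₀ _ hv.ne']
    linarith [le_abs_self r, abs_nonneg R]
  have := hR (mem_image_of_mem ψ hmem)
  rw [map_smul, smul_eq_mul, div_mul_cancel₀ _ hv.ne'] at this
  linarith [le_abs_self R, abs_nonneg r]

/-- The image of a component of the preimage of a continuum `A` under an oriented map does not lie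
on one side of a line through a point of `A`. -/
theorem exists_le_of_mem_component {f : ℂ → ℂ} (hc : Continuous f)
    (hperf : ∀ K : Set ℂ, IsCompact K → IsCompact (f ⁻¹' K))
    (horient : ∀ γ : ℝ → ℂ, JordanLoop γ → ∀ x ∈ topHull (range γ), f x ∈ topHull (f '' range γ))
    {A : Set ℂ} (hA : IsCompact A) (hAc : IsPreconnected A) {x : ℂ} (hx : f x ∈ A) {a : ℂ}
    (ha : a ∈ A) {ψ : ℂ →L[ℝ] ℝ} {v : ℂ} (hv : 0 < ψ v) :
    ∃ z ∈ connectedComponentIn (f ⁻¹' A) x, ψ a ≤ ψ (f z) := by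
  by_contra! hlt
  obtain ⟨L', -, hL'c, hrest, hxL', hL'V⟩ := exists_isCompact_split (hperf A hA)
    (isOpen_lt (ψ.continuous.comp hc) continuous_const) (show x ∈ f ⁻¹' A from hx)
    (show _ ⊆ {z | (ψ ∘ f) z < ψ a} from hlt)
  obtain ⟨γ, hγ, hrange, hhull⟩ := exists_jordanLoop_subset hL'c
    ((isOpen_lt (ψ.continuous.comp hc) continuous_const).inter hrest.isClosed.isOpen_compl)
    (show L' ⊆ {z | (ψ ∘ f) z < ψ a} ∩ (f ⁻¹' A \ L')ᶜ from
      fun z hz => ⟨hL'V hz, fun h => h.2 hz⟩) hxL'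
  have hsub : A ∪ {w | ψ a ≤ ψ w} ⊆ (f '' range γ)ᶜ := by
    rintro _ hw ⟨z, hz, rfl⟩
    obtain ⟨⟨h1, h2⟩, h3⟩ := hrange hz
    rcases hw with hw | hw
    · exact h2 ⟨hw, h3⟩
    · exact not_le_of_gt h1 (show ψ a ≤ ψ (f z) from hw)
  have hconn : IsPreconnected (A ∪ {w | ψ a ≤ ψ w}) :=
    IsPreconnected.union a ha (le_refl (ψ a)) hAc
      (convex_halfSpace_ge ψ.toLinearMap.isLinear (ψ a)).isPreconnected
  have hfx : f x ∈ A ∪ {w | ψ a ≤ ψ w} := Or.inl hx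
  rcases horient γ hγ x hhull with h | ⟨-, hb⟩
  · exact hsub hfx h
  · exact not_isBounded_halfSpace hv (ψ a) (hb.subset
      (subset_union_right.trans (hconn.subset_connectedComponentIn hfx hsub)))

/-- Oriented maps are confluent over segments. -/
theorem exists_mem_component_preimage_segment {f : ℂ → ℂ} (hc : Continuous f)
    (hperf : ∀ K : Set ℂ, IsCompact K → IsCompact (f ⁻¹' K))
    (horient : ∀ γ : ℝ → ℂ, JordanLoop γ → ∀ x ∈ topHull (range γ), f x ∈ topHull (f '' range γ))
    {x b : ℂ} : ∃ z ∈ connectedComponentIn (f ⁻¹' segment ℝ (f x) b) x, f z = b := by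
  have hA : IsCompact (segment ℝ (f x) b) := by
    rw [segment_eq_image_lineMap]
    exact isCompact_Icc.image AffineMap.lineMap_continuous
  have hxA : f x ∈ segment ℝ (f x) b := left_mem_segment ℝ _ _
  by_cases hb : f x = b
  · exact ⟨x, mem_connectedComponentIn hxA, hb⟩
  let ψ : ℂ →L[ℝ] ℝ := innerSL ℝ (b - f x)
  have hψ : 0 < ψ (b - f x) := by
    simp only [ψ, innerSL_apply_apply]
    exact real_inner_self_pos.2 (sub_ne_zero.2 (Ne.symm hb))
  obtain ⟨z, hz, hle⟩ := exists_le_of_mem_component hc hperf horient hA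
    (convex_segment _ _).isPreconnected hxA (right_mem_segment ℝ _ _) hψ
  refine ⟨z, hz, ?_⟩
  have hzA : f z ∈ segment ℝ (f x) b :=
    connectedComponentIn_subset (f ⁻¹' _) _ hz
  rw [segment_eq_image'] at hzA
  obtain ⟨t, ⟨-, ht1⟩, ht⟩ := hzA
  have : t = 1 := by
    refine le_antisymm ht1 ?_
    rw [← ht, map_add, map_smul, smul_eq_mul] at hle
    rw [map_sub] at hle hψ
    nlinarith
  rw [← ht, this]
  simp

/-- A surjective oriented (perfect continuous) map of the plane is confluent:
for every subcontinuum `K` and every component `C` of `f⁻¹(K)`, `f(C) = K`. -/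
theorem oriented_map_is_confluent (f : ℂ → ℂ) (hc : Continuous f)
    (hsurj : Function.Surjective f)
    (hperf : ∀ K : Set ℂ, IsCompact K → IsCompact (f ⁻¹' K))
    (horient : ∀ γ : ℝ → ℂ, JordanLoop γ → ∀ x ∈ topHull (Set.range γ),
      f x ∈ topHull (f '' Set.range γ)) :
    ∀ K : Set ℂ, IsCompact K → IsConnected K →
      ∀ x ∈ f ⁻¹' K, f '' connectedComponentIn (f ⁻¹' K) x = K := by
  intro K hK hKc x hx
  refine (image_subset_iff.2 (connectedComponentIn_subset _ _)).antisymm fun y hy => ?_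
  by_contra hcon
  obtain ⟨L', hL'L, hL'c, hrest, hxL', hL'V⟩ := exists_isCompact_split (hperf K hK)
    (isOpen_compl_singleton.preimage hc) hx
    (show connectedComponentIn (f ⁻¹' K) x ⊆ f ⁻¹' {y}ᶜ from fun z hz hzy => hcon ⟨z, hz, hzy⟩)
  obtain ⟨U₁, U₂, hU₁, hU₂, hLU₁, hLU₂, hdisj⟩ :=
    SeparatedNhds.of_isCompact_isCompact hL'c hrest disjoint_sdiff_self_right
  let O := U₁ ∩ f ⁻¹' {y}ᶜ
  have hO : IsOpen O := hU₁.inter (isOpen_compl_singleton.preimage hc)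
  obtain ⟨⟨ε, hε⟩, hεsub⟩ := exists_subset_nhds_of_isCompact
    (V := fun ε : {ε : ℝ // 0 < ε} => f ⁻¹' Metric.cthickening ε K) (U := O ∪ U₂)
    (fun ε δ => ⟨⟨min ε δ, lt_min ε.2 δ.2⟩,
      preimage_mono (Metric.cthickening_mono (min_le_left _ _) K),
      preimage_mono (Metric.cthickening_mono (min_le_right _ _) K)⟩)
    (fun ε => hperf _ hK.cthickening) (by
      intro z hz
      refine (hO.union hU₂).mem_nhds ?_
      have hzK : f z ∈ K := by
        rw [← hK.isClosed.closure_eq, Metric.closure_eq_iInter_cthickening]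
        exact mem_iInter₂.2 fun ε hε => mem_iInter.1 hz ⟨ε, hε⟩
      by_cases hzL : z ∈ L'
      · exact Or.inl ⟨hLU₁ hzL, hL'V hzL⟩
      · exact Or.inr (hLU₂ ⟨hzK, hzL⟩))
  dsimp only at hεsub
  set D := connectedComponentIn (f ⁻¹' Metric.cthickening ε K) x with hD
  have hKε : K ⊆ Metric.cthickening ε K := Metric.self_subset_cthickening K
  have hDO : D ⊆ O := isPreconnected_connectedComponentIn.subset_left_of_subset_union hO hU₂
    (hdisj.mono_left inter_subset_left) ((connectedComponentIn_subset _ _).trans hεsub)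
    ⟨x, mem_connectedComponentIn (hKε hx), hLU₁ hxL', hL'V hxL'⟩
  have hchain : ∀ p ∈ K, ∀ q, dist q p ≤ ε → p ∈ f '' D → q ∈ f '' D := by
    rintro p hp q hpq ⟨z, hz, rfl⟩
    obtain ⟨w, hw, rfl⟩ := exists_mem_component_preimage_segment hc hperf horient (x := z) (b := q)
    refine ⟨w, ?_, rfl⟩
    rw [hD, connectedComponentIn_eq hz]
    refine connectedComponentIn_mono _ (preimage_mono ?_) hw
    refine Subset.trans ?_ (Metric.closedBall_subset_cthickening hp ε)
    exact (convex_closedBall _ _).segment_subset (Metric.mem_closedBall_self hε.le) hpq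
  have hyD : f x ∈ f '' D ↔ y ∈ f '' D := by
    refine hKc.isPreconnected.induction₂ (fun p q => p ∈ f '' D ↔ q ∈ f '' D) ?_ ?_ ?_ hx hy
    · intro p hp
      filter_upwards [self_mem_nhdsWithin,
        mem_nhdsWithin_of_mem_nhds (Metric.closedBall_mem_nhds p hε)]
        with q hq hpq
      exact ⟨hchain p hp q hpq, hchain q hq p (by rwa [dist_comm])⟩
    · intro p q r _ _ _ h1 h2
      exact h1.trans h2
    · intro p q _ _ h
      exact h.symm
  obtain ⟨z, hz, hzy⟩ := hyD.1 ⟨x, mem_connectedComponentIn (hKε hx), rfl⟩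
  exact (hDO hz).2 hzy
end

section
/- If f : ℂ → ℂ is a surjective confluent perfect map and X ⊂ ℂ is a non-separating continuum, then f(Bd(X)) ⊇ Bd(f(X)). -/
open Set

/-- A preconnected set meeting both a closed set and its complement meets its frontier. -/
theorem IsClosed.inter_frontier_nonempty_of_isPreconnected {α : Type*} [TopologicalSpace α]
    {s t : Set α} (ht : IsClosed t) (hs : IsPreconnected s) (h : (s ∩ t).Nonempty)
    (h' : (s ∩ tᶜ).Nonempty) : (s ∩ frontier t).Nonempty := by
  by_contra hne
  have hint : ∀ a ∈ s, a ∈ t → a ∈ interior t := fun a has hat => by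
    by_contra hai
    exact hne ⟨a, has, ht.frontier_eq ▸ ⟨hat, hai⟩⟩
  obtain ⟨a, has, hat⟩ := h
  obtain ⟨b, -, hbt, hbt'⟩ := hs (interior t) tᶜ isOpen_interior ht.isOpen_compl
    (fun c hcs => or_iff_not_imp_right.2 fun hct => hint c hcs (not_not.1 hct))
    ⟨a, has, hint a has hat⟩ h'
  exact hbt' (interior_subset hbt)

/-- If `f : ℂ → ℂ` is a surjective confluent perfect (continuous) map and `X` is a
non-separating continuum, then `f(Bd X) ⊇ Bd (f(X))`. -/
theorem confluent_boundary_image (f : ℂ → ℂ) (hc : Continuous f)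
    (hsurj : Function.Surjective f)
    (hperf : ∀ K : Set ℂ, IsCompact K → IsCompact (f ⁻¹' K))
    (hconf : ∀ K : Set ℂ, IsCompact K → IsConnected K →
      ∀ x ∈ f ⁻¹' K, f '' connectedComponentIn (f ⁻¹' K) x = K)
    (X : Set ℂ) (hXc : IsCompact X) (hXconn : IsConnected X)
    (hXnonsep : IsConnected Xᶜ) :
    frontier (f '' X) ⊆ f '' frontier X := by
  intro y hy
  by_contra hyn
  have hclosed : IsClosed (f '' frontier X) :=
    ((hXc.of_isClosed_subset isClosed_frontier hXc.isClosed.frontier_subset).image hc).isClosed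
  obtain ⟨r, hr, hball⟩ :=
    Metric.nhds_basis_closedBall.mem_iff.1 (hclosed.isOpen_compl.mem_nhds hyn)
  obtain ⟨x, hxX, rfl⟩ := (hXc.image hc).isClosed.frontier_subset hy
  have hyc : f x ∈ closure (f '' X)ᶜ := by
    rw [frontier_eq_closure_inter_closure] at hy
    exact hy.2
  obtain ⟨w, hwX, hw⟩ := Metric.mem_closure_iff.1 hyc r hr
  set K := Metric.closedBall (f x) r
  have hKconn : IsConnected K :=
    (convex_closedBall (f x) r).isConnected (Metric.nonempty_closedBall.2 hr.le)
  have hxK : x ∈ f ⁻¹' K := Metric.mem_closedBall_self hr.le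
  have himage := hconf K (isCompact_closedBall _ _) hKconn x hxK
  have hwK : w ∈ K := Metric.mem_closedBall'.2 hw.le
  obtain ⟨v, hv, rfl⟩ := himage.symm ▸ hwK
  have hvX : v ∉ X := fun h => hwX (mem_image_of_mem f h)
  obtain ⟨z, hz, hzX⟩ := hXc.isClosed.inter_frontier_nonempty_of_isPreconnected
    isPreconnected_connectedComponentIn ⟨x, mem_connectedComponentIn hxK, hxX⟩ ⟨v, hv, hvX⟩
  exact hball (connectedComponentIn_subset (f ⁻¹' K) x hz) (mem_image_of_mem f hzX)
end

section
/- Let D be a dendrite, f : D → D continuous, and a ∈ D a fixed point such that in some component B of D \ {a}, there is a point x arbitrarily close to a with x separating a from f(x), and no fixed points of f in a neighborhood U of a in the closure of B other than a. Then there exists a sequence x = x₀, x₋₁, x₋₂, … in the arc (a, x) with f(x₋ₙ₋₁) = x₋ₙ, converging to a. -/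
open Set Filter

/-- `x` separates `y` from `z` in the space `D`: `y` and `z` lie in different
connected components of `D \ {x}`. -/
def Separates {D : Type*} [TopologicalSpace D] (x y z : D) : Prop :=
  y ≠ x ∧ z ≠ x ∧ connectedComponentIn {x}ᶜ y ≠ connectedComponentIn {x}ᶜ z

/-- A `δ`-chain `c` from `p` to `q`, indexed by `ℕ` and constant from index `M` on. -/
def IsFineChain {X : Type*} [PseudoMetricSpace X] (δ : ℝ) (p q : X) (M : ℕ) (c : ℕ → X) : Prop :=
  c 0 = p ∧ (∀ i, M ≤ i → c i = q) ∧ ∀ i, dist (c i) (c (i + 1)) < δ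

/-- Any two points of a preconnected set are joined by a `δ`-chain inside the set. -/
theorem IsPreconnected.exists_isFineChain {X : Type*} [PseudoMetricSpace X] {s : Set X}
    (hs : IsPreconnected s) {p q : X} (hp : p ∈ s) (hq : q ∈ s) {δ : ℝ} (hδ : 0 < δ) :
    ∃ M c, IsFineChain δ p q M c ∧ ∀ i, c i ∈ s := by
  have hrel : Relation.ReflTransGen (fun u v => u ∈ s ∧ v ∈ s ∧ dist u v < δ) p q := by
    refine hs.induction₂'
      (Relation.ReflTransGen (fun u v => u ∈ s ∧ v ∈ s ∧ dist u v < δ)) ?_ ?_ hp hq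
    · intro x hx
      filter_upwards [self_mem_nhdsWithin,
        mem_nhdsWithin_of_mem_nhds (Metric.ball_mem_nhds x hδ)] with y hy hxy
      exact ⟨.single ⟨hx, hy, by rwa [dist_comm]⟩, .single ⟨hy, hx, hxy⟩⟩
    · intro x y z _ _ _ hxy hyz
      exact hxy.trans hyz
  induction hrel using Relation.ReflTransGen.head_induction_on with
  | refl => exact ⟨0, fun _ => q, ⟨rfl, fun _ _ => rfl, fun _ => by simpa using hδ⟩, fun _ => hq⟩
  | @head u v h _ ih =>
    obtain ⟨hu, hv, huv⟩ := h
    obtain ⟨M, c, ⟨h0, hM, hc⟩, hcs⟩ := ih hv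
    refine ⟨M + 1, fun i => Nat.casesOn i u c, ⟨rfl, ?_, ?_⟩, ?_⟩
    · rintro (_ | i) hi
      · omega
      · exact hM i (by omega)
    · rintro (_ | i)
      · simpa [h0] using huv
      · exact hc i
    · rintro (_ | i)
      · exact hu
      · exact hcs i

/-- A compact locally connected metric space is uniformly locally connected. -/
theorem exists_isPreconnected_of_dist_lt {X : Type*} [PseudoMetricSpace X] [CompactSpace X]
    [LocallyConnectedSpace X] {ε : ℝ} (hε : 0 < ε) :
    ∃ δ > 0, ∀ p q : X, dist p q < δ →
      ∃ s : Set X, IsPreconnected s ∧ p ∈ s ∧ q ∈ s ∧ ∀ z ∈ s, dist z p < ε := by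
  have hε2 : 0 < ε / 2 := half_pos hε
  obtain ⟨δ, hδ, h⟩ := lebesgue_number_lemma_of_metric (isCompact_univ (X := X))
    (c := fun x : X => connectedComponentIn (Metric.ball x (ε / 2)) x)
    (fun _ => Metric.isOpen_ball.connectedComponentIn)
    (fun x _ => mem_iUnion.2 ⟨x, mem_connectedComponentIn (Metric.mem_ball_self hε2)⟩)
  refine ⟨δ, hδ, fun p q hpq => ?_⟩
  obtain ⟨x, hx⟩ := h p (mem_univ p)
  have hp := hx (Metric.mem_ball_self hδ)
  refine ⟨_, isPreconnected_connectedComponentIn, hp,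
    hx (by rwa [Metric.mem_ball, dist_comm]), fun z hz => ?_⟩
  have hz' := connectedComponentIn_subset _ _ hz
  have hp' := connectedComponentIn_subset _ _ hp
  rw [Metric.mem_ball] at hz' hp'
  linarith [dist_triangle_right z p x]

/-- A `δ`-chain can be refined to a `ρ`-chain that subdivides each link into `k` links. -/
theorem IsFineChain.exists_refinement {X : Type*} [PseudoMetricSpace X] {δ ρ ε : ℝ} (hε : 0 < ε)
    (hpos : 0 < ρ)
    (h : ∀ p q : X, dist p q < δ →
      ∃ s : Set X, IsPreconnected s ∧ p ∈ s ∧ q ∈ s ∧ ∀ z ∈ s, dist z p < ε)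
    {p q : X} {M : ℕ} {c : ℕ → X} (hc : IsFineChain δ p q M c) :
    ∃ k c', 0 < k ∧ IsFineChain ρ p q (M * k) c' ∧ ∀ l, dist (c' l) (c (l / k)) < ε := by
  obtain ⟨h0, hM, hdist⟩ := hc
  have hlink : ∀ i, ∃ m e, IsFineChain ρ (c i) (c (i + 1)) m e ∧ (M ≤ i → m = 0) ∧
      ∀ j, dist (e j) (c i) < ε := by
    intro i
    by_cases hi : M ≤ i
    · exact ⟨0, fun _ => c i, ⟨rfl, fun _ _ => by rw [hM i hi, hM _ (hi.trans (Nat.le_succ i))],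
        fun _ => by simpa using hpos⟩, fun _ => rfl, fun _ => by simpa using hε⟩
    · obtain ⟨s, hs, hps, hqs, hsε⟩ := h _ _ (hdist i)
      obtain ⟨m, e, he, hes⟩ := hs.exists_isFineChain hps hqs hpos
      exact ⟨m, e, he, fun h => absurd h hi, fun j => hsε _ (hes j)⟩
  choose m e he hm heε using hlink
  set k := (Finset.range M).sup m + 1 with hk
  have hmk : ∀ i, m i < k := by
    intro i
    by_cases hi : M ≤ i
    · rw [hm i hi]; omega
    · exact Nat.lt_succ_of_le (Finset.le_sup (f := m) (Finset.mem_range.2 (not_le.1 hi)))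
  have hkpos : 0 < k := by omega
  refine ⟨k, fun l => e (l / k) (l % k), hkpos, ⟨?_, ?_, ?_⟩, fun l => heε _ _⟩
  · simp [(he 0).1, h0]
  · intro l hl
    have hMl : M ≤ l / k := (Nat.le_div_iff_mul_le hkpos).2 hl
    have h1 := (he (l / k)).2.1 (l % k) (by rw [hm _ hMl]; omega)
    simp only [h1]
    exact hM _ (by omega)
  · intro l
    by_cases hl : l % k + 1 < k
    · have hlk : l + 1 = k * (l / k) + (l % k + 1) := by rw [← add_assoc, Nat.div_add_mod]
      have h1 : (l + 1) / k = l / k := by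
        rw [hlk, Nat.mul_add_div hkpos, Nat.div_eq_of_lt hl, add_zero]
      have h2 : (l + 1) % k = l % k + 1 := by
        rw [hlk, Nat.mul_add_mod, Nat.mod_eq_of_lt hl]
      simp only [h1, h2]
      exact (he _).2.2 _
    · have hlt := Nat.mod_lt l hkpos
      have hlk : l + 1 = k * (l / k + 1) := by
        have := Nat.div_add_mod l k
        rw [mul_add]; omega
      have h1 : (l + 1) / k = l / k + 1 := by
        rw [hlk, Nat.mul_div_cancel_left _ hkpos]
      have h2 : (l + 1) % k = 0 := by
        rw [hlk, Nat.mul_mod_right]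
      have hmod := hmk (l / k)
      simp only [h1, h2]
      rw [(he _).2.1 (l % k) (by omega), (he _).1, dist_self]
      exact hpos

/-- In a compact locally connected metric space, sufficiently close points are joined by a path of
small diameter. -/
theorem exists_path_of_dist_lt {X : Type*} [MetricSpace X] [CompactSpace X]
    [LocallyConnectedSpace X] {ε : ℝ} (hε : 0 < ε) :
    ∃ δ > 0, ∀ p q : X, dist p q < δ → JoinedIn (Metric.closedBall p (2 * ε)) p q := by
  have hεn : ∀ n : ℕ, 0 < ε / 2 / 2 ^ n := fun n => by positivity
  have hδex : ∀ n : ℕ, ∃ δ > 0, δ ≤ ε / 2 / 2 ^ n ∧ ∀ p q : X, dist p q < δ →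
      ∃ s : Set X, IsPreconnected s ∧ p ∈ s ∧ q ∈ s ∧ ∀ z ∈ s, dist z p < ε / 2 / 2 ^ n := by
    intro n
    obtain ⟨δ, hδ, h⟩ := exists_isPreconnected_of_dist_lt (X := X) (hεn n)
    exact ⟨min δ (ε / 2 / 2 ^ n), lt_min hδ (hεn n), min_le_right _ _,
      fun p q hpq => h p q (hpq.trans_le (min_le_left _ _))⟩
  choose δ hδ hδε hconn using hδex
  refine ⟨δ 0, hδ 0, fun p q hpq => ?_⟩
  let T : ℕ → Type _ := fun n =>
    {x : ℕ × (ℕ → X) // 0 < x.1 ∧ IsFineChain (δ n) p q x.1 x.2}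
  have hstep : ∀ n (x : T n), ∃ y : T (n + 1), ∃ k : ℕ, 0 < k ∧ y.1.1 = x.1.1 * k ∧
      ∀ l, dist (y.1.2 l) (x.1.2 (l / k)) < ε / 2 / 2 ^ n := by
    rintro n ⟨⟨M, c⟩, hM, hc⟩
    obtain ⟨k, c', hk, hc', hd⟩ := hc.exists_refinement (hεn n) (hδ (n + 1)) (hconn n)
    exact ⟨⟨(M * k, c'), Nat.mul_pos hM hk, hc'⟩, k, hk, rfl, hd⟩
  choose next k hk hMk hnext using hstep
  let x₀ : T 0 := ⟨(1, fun i => if i = 0 then p else q), one_pos, by simp, by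
      intro i (hi : 1 ≤ i)
      exact if_neg (by omega), by
      rintro (_ | i)
      · simpa using hpq
      · simpa using hδ 0⟩
  let S : ∀ n, T n := fun n => Nat.rec x₀ next n
  let g : ℕ → ℝ → X := fun n t => (S n).1.2 ⌊((S n).1.1 : ℝ) * t⌋₊
  have hg : ∀ t n, dist (g n t) (g (n + 1) t) ≤ ε / 2 / 2 ^ n := by
    intro t n
    have h1 := hnext n (S n) ⌊((S (n + 1)).1.1 : ℝ) * t⌋₊
    have h2 : ⌊((S (n + 1)).1.1 : ℝ) * t⌋₊ / k n (S n) = ⌊((S n).1.1 : ℝ) * t⌋₊ := by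
      rw [← Nat.floor_div_natCast]
      have h3 : (S (n + 1)).1.1 = (S n).1.1 * k n (S n) := hMk n (S n)
      have h4 : (k n (S n) : ℝ) ≠ 0 := by exact_mod_cast (hk n (S n)).ne'
      rw [h3]
      push_cast
      congr 1
      field_simp
    rw [h2, dist_comm] at h1
    exact h1.le
  choose G hG using fun t =>
    cauchySeq_tendsto_of_complete (cauchySeq_of_le_geometric_two (hg t))
  have hGd : ∀ t n, dist (g n t) (G t) ≤ ε / 2 ^ n := fun t n =>
    dist_le_of_le_geometric_two_of_tendsto (hg t) (hG t) n
  have hlinks : ∀ n i j, i ≤ j → j ≤ i + 1 → dist ((S n).1.2 i) ((S n).1.2 j) ≤ ε / 2 ^ n := by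
    intro n i j hij hji
    have h3 : ε / 2 / 2 ^ n ≤ ε / 2 ^ n := by gcongr; linarith
    obtain rfl | rfl : j = i ∨ j = i + 1 := by omega
    · rw [dist_self]; positivity
    · exact ((S n).2.2.2.2 i).le.trans ((hδε n).trans h3)
  have hosc : ∀ n s t, s ≤ t → t - s < 1 / ((S n).1.1 : ℝ) →
      dist (g n s) (g n t) ≤ ε / 2 ^ n := by
    intro n s t hst hts
    have hMpos : (0 : ℝ) < (S n).1.1 := by exact_mod_cast (S n).2.1
    apply hlinks
    · exact Nat.floor_mono (by gcongr)
    · rw [lt_div_iff₀ hMpos] at hts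
      have h5 : ((S n).1.1 : ℝ) * t ≤ (S n).1.1 * s + 1 := by nlinarith
      rcases le_total 0 (((S n).1.1 : ℝ) * s) with h0 | h0
      · rw [← Nat.floor_add_one h0]
        exact Nat.floor_mono h5
      · have h6 : ⌊((S n).1.1 : ℝ) * t⌋₊ ≤ ⌊(1 : ℝ)⌋₊ := Nat.floor_mono (by linarith)
        simp at h6 ⊢
        omega
  have hcont : Continuous G := by
    have hclose : ∀ n s t, s ≤ t → t - s < 1 / ((S n).1.1 : ℝ) →
        dist (G s) (G t) ≤ 3 * (ε / 2 ^ n) := by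
      intro n s t hst hts
      linarith [dist_triangle4_left (g n s) (g n t) (G s) (G t), hGd s n, hGd t n,
        hosc n s t hst hts]
    rw [Metric.continuous_iff]
    intro t η hη
    obtain ⟨n, hn⟩ := exists_pow_lt_of_lt_one (show 0 < η / (3 * ε) by positivity)
      (show (1 / 2 : ℝ) < 1 by norm_num)
    have hn' : 3 * (ε / 2 ^ n) < η := by
      rw [lt_div_iff₀ (by positivity)] at hn
      calc 3 * (ε / 2 ^ n) = (1 / 2) ^ n * (3 * ε) := by rw [div_pow, one_pow]; ring
        _ < η := hn
    have hMpos : (0 : ℝ) < (S n).1.1 := by exact_mod_cast (S n).2.1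
    refine ⟨1 / (S n).1.1, by positivity, fun s hs => lt_of_le_of_lt ?_ hn'⟩
    rw [Real.dist_eq, abs_lt] at hs
    rcases le_total s t with h | h
    · exact hclose n s t h (by linarith)
    · rw [dist_comm]
      exact hclose n t s h (by linarith)
  refine JoinedIn.ofLine hcont.continuousOn ?_ ?_ ?_
  · refine tendsto_nhds_unique (hG 0) (tendsto_const_nhds.congr fun n => ?_)
    simp [g, (S n).2.2.1]
  · refine tendsto_nhds_unique (hG 1) (tendsto_const_nhds.congr fun n => ?_)
    simp [g, (S n).2.2.2.1]
  · rintro _ ⟨t, ht, rfl⟩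
    have h1 := hGd t 0
    have h2 : dist p (g 0 t) ≤ ε := by
      have h3 : g 0 t = if ⌊t⌋₊ = 0 then p else q := by
        change (if ⌊((1 : ℕ) : ℝ) * t⌋₊ = 0 then p else q) = _
        rw [Nat.cast_one, one_mul]
      have h4 := hδε 0
      rw [h3]
      split_ifs
      · rw [dist_self]; exact hε.le
      · rw [pow_zero, div_one] at h4
        linarith
    rw [Metric.mem_closedBall, dist_comm]
    rw [pow_zero, div_one] at h1
    linarith [dist_triangle p (g 0 t) (G t)]

/-- A compact locally connected metric space is locally path connected. -/
theorem locallyPathConnectedSpace_of_compactSpace {X : Type*} [MetricSpace X]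
    [CompactSpace X] [LocallyConnectedSpace X] : LocallyPathConnectedSpace X := by
  rw [locallyPathConnectedSpace_iff_pathComponentIn_mem_nhds]
  intro x u hu hx
  obtain ⟨ε, hε, hball⟩ := Metric.isOpen_iff.1 hu x hx
  obtain ⟨δ, hδ, h⟩ := exists_path_of_dist_lt (X := X) (show 0 < ε / 4 by positivity)
  filter_upwards [Metric.ball_mem_nhds x hδ] with y hy
  refine (h x y (by rwa [dist_comm])).mono ((Metric.closedBall_subset_ball ?_).trans hball)
  linarith

/-- `C` is a closed set of times in `[0, 1]` such that `γ` takes the same value at both ends of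
every gap of `C`: the path `γ` may jump over the gaps of `C`. -/
structure IsErasure {X : Type*} (γ : ℝ → X) (C : Set ℝ) : Prop where
  isClosed : IsClosed C
  subset : C ⊆ Icc 0 1
  zero_mem : (0 : ℝ) ∈ C
  one_mem : (1 : ℝ) ∈ C
  eq_of_gap : ∀ s ∈ C, ∀ t ∈ C, s < t → (∀ u ∈ C, u ≤ s ∨ t ≤ u) → γ s = γ t

theorem IsErasure.isCompact {X : Type*} {γ : ℝ → X} {C : Set ℝ} (h : IsErasure γ C) :
    IsCompact C :=
  isCompact_Icc.of_isClosed_subset h.isClosed h.subset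

theorem IsErasure.Icc {X : Type*} (γ : ℝ → X) : IsErasure γ (Icc 0 1) where
  isClosed := isClosed_Icc
  subset := Subset.rfl
  zero_mem := by simp
  one_mem := by simp
  eq_of_gap s hs t ht hst h := by
    rcases h ((s + t) / 2) ⟨by linarith [hs.1, ht.1], by linarith [hs.2, ht.2]⟩ with h | h <;>
      linarith

theorem IsErasure.sInter {X : Type*} [TopologicalSpace X] [T2Space X] {γ : ℝ → X}
    (hγ : Continuous γ) {c : Set (Set ℝ)} (hc : ∀ C ∈ c, IsErasure γ C)
    (hchain : IsChain (· ⊆ ·) c) (hne : c.Nonempty) : IsErasure γ (⋂₀ c) where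
  isClosed := isClosed_sInter fun C hC => (hc C hC).isClosed
  subset := by
    obtain ⟨C, hC⟩ := hne
    exact (sInter_subset_of_mem hC).trans (hc C hC).subset
  zero_mem := fun C hC => (hc C hC).zero_mem
  one_mem := fun C hC => (hc C hC).one_mem
  eq_of_gap s hs t ht hst hgap := by
    by_contra hne'
    obtain ⟨V, W, hV, hW, hsV, htW, hVW⟩ := t2_separation hne'
    obtain ⟨η₁, hη₁, hball₁⟩ := Metric.isOpen_iff.1 (hV.preimage hγ) s hsV
    obtain ⟨η₂, hη₂, hball₂⟩ := Metric.isOpen_iff.1 (hW.preimage hγ) t htW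
    obtain ⟨η, hη, hηlt⟩ : ∃ η > 0, η < min (min η₁ η₂) ((t - s) / 2) :=
      exists_between (lt_min (lt_min hη₁ hη₂) (by linarith))
    simp only [lt_min_iff] at hηlt
    obtain ⟨⟨hηη₁, hηη₂⟩, hηst⟩ := hηlt
    have : Nonempty c := hne.to_subtype
    obtain ⟨⟨C, hC⟩, hCempty⟩ :=
      (isCompact_Icc (a := s + η) (b := t - η)).elim_directed_family_closed
      (fun C : c => (C : Set ℝ)) (fun C => (hc C C.2).isClosed)
      (by
        rw [← sInter_eq_iInter]
        refine eq_empty_of_forall_notMem fun u ⟨hu, huc⟩ => ?_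
        rcases hgap u huc with h | h <;> linarith [hu.1, hu.2])
      (fun A B => (hchain.total A.2 B.2).elim (fun h => ⟨A, Subset.rfl, h⟩)
        fun h => ⟨B, h, Subset.rfl⟩)
    have hEC := hc C hC
    obtain ⟨s', ⟨hs'C, hs'⟩, hs'max⟩ := (hEC.isCompact.inter_right
      (isClosed_Icc (a := s) (b := s + η))).exists_isGreatest ⟨s, hs C hC, by simp [hη.le]⟩
    obtain ⟨t', ⟨ht'C, ht'⟩, ht'min⟩ := (hEC.isCompact.inter_right
      (isClosed_Icc (a := t - η) (b := t))).exists_isLeast ⟨t, ht C hC, by simp [hη.le]⟩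
    have heq : γ s' = γ t' := by
      refine hEC.eq_of_gap s' hs'C t' ht'C (by linarith [hs'.2, ht'.1]) fun u hu => ?_
      by_cases h1 : u < s
      · exact .inl (h1.le.trans hs'.1)
      by_cases h2 : t < u
      · exact .inr (ht'.2.trans h2.le)
      by_cases h3 : u ≤ s + η
      · exact .inl (hs'max ⟨hu, not_lt.1 h1, h3⟩)
      by_cases h4 : t - η ≤ u
      · exact .inr (ht'min ⟨hu, h4, not_lt.1 h2⟩)
      exact absurd (show u ∈ Set.Icc (s + η) (t - η) ∩ C from
        ⟨⟨(not_le.1 h3).le, (not_le.1 h4).le⟩, hu⟩) (by rw [hCempty]; exact notMem_empty u)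
    have hs'V : γ s' ∈ V := hball₁ (by
      rw [Metric.mem_ball, Real.dist_eq, abs_lt]
      constructor <;> linarith [hs'.1, hs'.2])
    have ht'W : γ t' ∈ W := hball₂ (by
      rw [Metric.mem_ball, Real.dist_eq, abs_lt]
      constructor <;> linarith [ht'.1, ht'.2])
    exact disjoint_left.1 hVW hs'V (heq ▸ ht'W)

theorem IsErasure.diff_Ioo {X : Type*} {γ : ℝ → X} {C : Set ℝ} (hC : IsErasure γ C) {s t : ℝ}
    (hs : s ∈ C) (ht : t ∈ C) (h : γ s = γ t) : IsErasure γ (C \ Ioo s t) where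
  isClosed := hC.isClosed.sdiff isOpen_Ioo
  subset := sdiff_subset.trans hC.subset
  zero_mem := ⟨hC.zero_mem, fun h0 => absurd h0.1 (not_lt.2 (hC.subset hs).1)⟩
  one_mem := ⟨hC.one_mem, fun h1 => absurd h1.2 (not_lt.2 (hC.subset ht).2)⟩
  eq_of_gap s' hs' t' ht' hst' hgap := by
    by_cases hall : ∀ u ∈ C, u ≤ s' ∨ t' ≤ u
    · exact hC.eq_of_gap s' hs'.1 t' ht'.1 hst' hall
    push Not at hall
    obtain ⟨u, huC, hsu, hut⟩ := hall
    have hu : u ∈ Ioo s t := by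
      by_contra hu
      rcases hgap u ⟨huC, hu⟩ with h | h <;> linarith
    have h1 : s ≤ s' := (hgap s ⟨hs, fun h => lt_irrefl _ h.1⟩).resolve_right fun h => by
      linarith [hu.1]
    have h2 : t' ≤ t := (hgap t ⟨ht, fun h => lt_irrefl _ h.2⟩).resolve_left fun h => by
      linarith [hu.2]
    have h3 : s' = s := le_antisymm
      (not_lt.1 fun h => hs'.2 ⟨h, hsu.trans hu.2⟩) h1
    have h4 : t' = t := le_antisymm h2
      (not_lt.1 fun h => ht'.2 ⟨hu.1.trans hut, h⟩)
    rw [h3, h4, h]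

/-- A path has an erasure on which it is injective up to identifying the ends of gaps. -/
theorem exists_isErasure_gap_of_eq {X : Type*} [TopologicalSpace X] [T2Space X] {γ : ℝ → X}
    (hγ : Continuous γ) : ∃ C, IsErasure γ C ∧
      ∀ s ∈ C, ∀ t ∈ C, s < t → γ s = γ t → ∀ u ∈ C, u ≤ s ∨ t ≤ u := by
  obtain ⟨C, -, hC⟩ := zorn_superset_nonempty {C | IsErasure γ C}
    (fun c hc hchain hne => ⟨⋂₀ c, IsErasure.sInter hγ hc hchain hne,
      fun s hs => sInter_subset_of_mem hs⟩) _ (IsErasure.Icc γ)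
  refine ⟨C, hC.prop, fun s hs t ht hst h u hu => ?_⟩
  by_contra! hcon
  exact (hC.le_of_le (hC.prop.diff_Ioo hs ht h) sdiff_subset hu).2 hcon

/-- The distance from a point to the part of a path traversed up to time `t` varies continuously
with `t`. -/
theorem continuousOn_infDist_image_inter_Iic {X : Type*} [PseudoMetricSpace X] {γ : ℝ → X}
    (hγ : Continuous γ) (C : Set ℝ) (x : X) :
    ContinuousOn (fun t => Metric.infDist x (γ '' (C ∩ Iic t))) C := by
  rw [Metric.continuousOn_iff]
  intro c hc ε hε
  obtain ⟨δ, hδ, hball⟩ := Metric.continuous_iff.1 hγ c (ε / 4) (by positivity)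
  have key : ∀ c₁ ∈ C, ∀ c₂ ∈ C, c₁ ≤ c₂ → dist c₁ c < δ → dist c₂ c < δ →
      dist (Metric.infDist x (γ '' (C ∩ Iic c₂))) (Metric.infDist x (γ '' (C ∩ Iic c₁))) < ε := by
    intro c₁ hc₁ c₂ hc₂ h12 hd₁ hd₂
    have hmem : ∀ c ∈ C, γ c ∈ γ '' (C ∩ Iic c) := fun c hc =>
      mem_image_of_mem _ ⟨hc, mem_Iic.2 le_rfl⟩
    have h1 : Metric.infDist x (γ '' (C ∩ Iic c₂)) ≤ Metric.infDist x (γ '' (C ∩ Iic c₁)) :=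
      Metric.infDist_le_infDist_of_subset (image_mono (by gcongr)) ⟨_, hmem c₁ hc₁⟩
    have h2 : Metric.infDist x (γ '' (C ∩ Iic c₁)) - ε / 2 ≤
        Metric.infDist x (γ '' (C ∩ Iic c₂)) := by
      rw [Metric.le_infDist ⟨_, hmem c₂ hc₂⟩]
      rintro _ ⟨u, ⟨huC, hu⟩, rfl⟩
      rcases le_total u c₁ with h | h
      · linarith [Metric.infDist_le_dist_of_mem (x := x)
          (mem_image_of_mem γ (show u ∈ C ∩ Iic c₁ from ⟨huC, h⟩))]
      · have hu' : dist u c < δ := by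
          rw [Real.dist_eq, abs_lt] at hd₁ hd₂ ⊢
          rw [mem_Iic] at hu
          constructor <;> linarith [hd₁.1, hd₂.2]
        linarith [Metric.infDist_le_dist_of_mem (x := x) (hmem c₁ hc₁), hball u hu',
          hball c₁ hd₁, dist_triangle x (γ u) (γ c₁), dist_triangle_right (γ u) (γ c₁) (γ c)]
    rw [Real.dist_eq, abs_lt]
    constructor <;> linarith
  refine ⟨δ, hδ, fun c' hc' hd => ?_⟩
  rcases le_total c c' with h | h
  · exact key c hc c' hc' h (by simpa using hδ) hd
  · rw [dist_comm]
    exact key c' hc' c hc h hd (by simpa using hδ)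

/-- A path that is injective on `C` up to identifying the ends of gaps admits a monotone continuous
parameter on `C` with the same fibers. -/
theorem exists_monotoneOn_parameter {X : Type*} [MetricSpace X] [CompactSpace X] {γ : ℝ → X}
    (hγ : Continuous γ) {C : Set ℝ} (hC : IsCompact C)
    (hgap : ∀ s ∈ C, ∀ t ∈ C, s < t → γ s = γ t → ∀ u ∈ C, u ≤ s ∨ t ≤ u) :
    ∃ φ : ℝ → ℝ, ContinuousOn φ C ∧ MonotoneOn φ C ∧
      ∀ s ∈ C, ∀ t ∈ C, φ s = φ t ↔ γ s = γ t := by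
  have : Nonempty X := ⟨γ 0⟩
  let d := TopologicalSpace.denseSeq X
  let A : ℝ → Set X := fun t => γ '' (C ∩ Iic t)
  let F : ℕ → ℝ → ℝ := fun n t => (1 / 2) ^ n * Metric.infDist (d n) (A t)
  have hmem : ∀ t ∈ C, γ t ∈ A t := fun t ht => mem_image_of_mem _ ⟨ht, mem_Iic.2 le_rfl⟩
  have hFnn : ∀ n t, 0 ≤ F n t := fun n t => mul_nonneg (by positivity) Metric.infDist_nonneg
  have hFle : ∀ n, ∀ t ∈ C, F n t ≤ (1 / 2) ^ n * Metric.diam (univ : Set X) := by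
    intro n t ht
    refine mul_le_mul_of_nonneg_left ?_ (by positivity)
    exact (Metric.infDist_le_dist_of_mem (hmem t ht)).trans
      (Metric.dist_le_diam_of_mem isCompact_univ.isBounded (mem_univ _) (mem_univ _))
  have hsum : Summable fun n : ℕ => (1 / 2 : ℝ) ^ n * Metric.diam (univ : Set X) :=
    summable_geometric_two.mul_right _
  have hFsum : ∀ t ∈ C, Summable fun n => F n t := fun t ht =>
    .of_nonneg_of_le (fun n => hFnn n t) (fun n => hFle n t ht) hsum
  have hFanti : ∀ n, ∀ s ∈ C, ∀ t, s ≤ t → F n t ≤ F n s := by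
    intro n s hs t hst
    refine mul_le_mul_of_nonneg_left ?_ (by positivity)
    exact Metric.infDist_le_infDist_of_subset (image_mono (by gcongr)) ⟨_, hmem s hs⟩
  have hlt : ∀ s ∈ C, ∀ t ∈ C, s < t → γ s ≠ γ t → ∑' n, F n t < ∑' n, F n s := by
    intro s hs t ht hst hne
    have hnot : γ t ∉ A s := by
      rintro ⟨u, ⟨huC, hu⟩, hut⟩
      rw [mem_Iic] at hu
      rcases hgap u huC t ht (hu.trans_lt hst) hut s hs with h | h
      · exact hne (le_antisymm h hu ▸ hut)
      · linarith
    have hAclosed : IsClosed (A s) := ((hC.inter_right isClosed_Iic).image hγ).isClosed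
    have hpos : 0 < Metric.infDist (γ t) (A s) :=
      (hAclosed.notMem_iff_infDist_pos ⟨_, hmem s hs⟩).1 hnot
    obtain ⟨n, hn⟩ := (TopologicalSpace.denseRange_denseSeq X).exists_dist_lt (γ t) (half_pos hpos)
    refine Summable.tsum_lt_tsum (i := n) (fun n => hFanti n s hs t hst.le) ?_
      (hFsum t ht) (hFsum s hs)
    refine mul_lt_mul_of_pos_left ?_ (by positivity)
    have h1 : Metric.infDist (d n) (A t) ≤ dist (d n) (γ t) :=
      Metric.infDist_le_dist_of_mem (hmem t ht)
    have h2 := Metric.infDist_le_infDist_add_dist (s := A s) (x := γ t) (y := d n)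
    rw [dist_comm] at h1
    change dist (γ t) (d n) < _ at hn
    linarith
  have heq : ∀ s ∈ C, ∀ t ∈ C, s < t → γ s = γ t → ∑' n, F n t = ∑' n, F n s := by
    intro s hs t ht hst h
    have hA : A t = A s := by
      refine subset_antisymm ?_ (image_mono (by gcongr))
      rintro _ ⟨u, ⟨huC, hu⟩, rfl⟩
      rcases hgap s hs t ht hst h u huC with h' | h'
      · exact mem_image_of_mem _ ⟨huC, h'⟩
      · rw [le_antisymm hu h', ← h]
        exact hmem s hs
    simp only [F, hA]
  refine ⟨fun t => -∑' n, F n t, ?_, ?_, ?_⟩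
  · refine (continuousOn_tsum (fun n => ?_) hsum fun n t ht => ?_).neg
    · exact continuousOn_const.mul (continuousOn_infDist_image_inter_Iic hγ C (d n))
    · rw [Real.norm_of_nonneg (hFnn n t)]
      exact hFle n t ht
  · intro s hs t ht hst
    exact neg_le_neg
      (Summable.tsum_le_tsum (fun n => hFanti n s hs t hst) (hFsum t ht) (hFsum s hs))
  · have hiff : ∀ s ∈ C, ∀ t ∈ C, s < t → (∑' n, F n s = ∑' n, F n t ↔ γ s = γ t) := by
      intro s hs t ht hst
      refine ⟨fun h => ?_, fun h => (heq s hs t ht hst h).symm⟩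
      by_contra hne
      exact (hlt s hs t ht hst hne).ne' h
    intro s hs t ht
    rw [neg_inj]
    rcases lt_trichotomy s t with h | rfl | h
    · exact hiff s hs t ht h
    · simp
    · rw [eq_comm, hiff t ht s hs h, eq_comm]

/-- In a compact metric space, distinct points joined by a path in `F` are joined by an arc
in `F`. -/
theorem JoinedIn.exists_arc {X : Type*} [MetricSpace X] [CompactSpace X] {F : Set X} {p q : X}
    (h : JoinedIn F p q) (hpq : p ≠ q) :
    ∃ α : ℝ → X, ContinuousOn α (Icc 0 1) ∧ InjOn α (Icc 0 1) ∧ α 0 = p ∧ α 1 = q ∧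
      MapsTo α (Icc 0 1) F := by
  obtain ⟨γ, hγF⟩ := h
  let g : ℝ → X := γ.extend
  have hg : Continuous g := γ.continuous_extend
  have hg0 : g 0 = p := γ.extend_zero
  have hg1 : g 1 = q := γ.extend_one
  have hgF : ∀ t, g t ∈ F := fun t => by
    have : g t ∈ range γ := by rw [← γ.extend_range]; exact mem_range_self t
    obtain ⟨u, hu⟩ := this
    exact hu ▸ hγF u
  obtain ⟨C, hC, hgap⟩ := exists_isErasure_gap_of_eq hg
  obtain ⟨φ, hφ, hmono, hiff⟩ := exists_monotoneOn_parameter hg hC.isCompact hgap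
  have h01 : φ 0 < φ 1 := lt_of_le_of_ne
    (hmono hC.zero_mem hC.one_mem zero_le_one)
    (fun h => hpq (by rw [← hg0, ← hg1]; exact (hiff 0 hC.zero_mem 1 hC.one_mem).1 h))
  have hsurj : ∀ r ∈ Icc (φ 0) (φ 1), ∃ c ∈ C, φ c = r := by
    intro r hr
    by_contra! hcon
    obtain ⟨s, ⟨hsC, hs⟩, hsmax⟩ := (hC.isCompact.of_isClosed_subset
      (hφ.preimage_isClosed_of_isClosed hC.isClosed (isClosed_Iic (a := r)))
      inter_subset_left).exists_isGreatest ⟨0, hC.zero_mem, hr.1⟩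
    obtain ⟨t, ⟨htC, ht⟩, htmin⟩ := (hC.isCompact.of_isClosed_subset
      (hφ.preimage_isClosed_of_isClosed hC.isClosed (isClosed_Ici (a := r)))
      inter_subset_left).exists_isLeast ⟨1, hC.one_mem, hr.2⟩
    have hsr : φ s < r := lt_of_le_of_ne hs (hcon s hsC)
    have hrt : r < φ t := lt_of_le_of_ne ht (hcon t htC).symm
    have hst : s < t := by
      by_contra! hts
      linarith [hmono htC hsC hts]
    have heq := hC.eq_of_gap s hsC t htC hst fun u hu =>
      (le_total (φ u) r).imp (fun h => hsmax ⟨hu, h⟩) (fun h => htmin ⟨hu, h⟩)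
    linarith [(hiff s hsC t htC).2 heq]
  choose! σ hσC hσ using hsurj
  let ρ : ℝ → ℝ := fun t => φ 0 + t * (φ 1 - φ 0)
  have hρ : MapsTo ρ (Icc 0 1) (Icc (φ 0) (φ 1)) := fun t ht =>
    ⟨by simp only [ρ]; nlinarith [ht.1], by simp only [ρ]; nlinarith [ht.2]⟩
  have hcont : ContinuousOn (g ∘ σ) (Icc (φ 0) (φ 1)) := by
    rw [continuousOn_iff_isClosed]
    intro T hT
    refine ⟨φ '' (C ∩ g ⁻¹' T), ((hC.isCompact.inter_right (hT.preimage hg)).image_of_continuousOn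
      (hφ.mono inter_subset_left)).isClosed, ?_⟩
    ext r
    constructor
    · rintro ⟨hrT, hr⟩
      exact ⟨⟨σ r, ⟨hσC r hr, hrT⟩, hσ r hr⟩, hr⟩
    · rintro ⟨⟨c, ⟨hcC, hcT⟩, rfl⟩, hr⟩
      refine ⟨?_, hr⟩
      have := (hiff _ (hσC _ hr) c hcC).1 (hσ _ hr)
      simpa only [mem_preimage, Function.comp, this] using hcT
  have hl : φ 0 ∈ Icc (φ 0) (φ 1) := left_mem_Icc.2 h01.le
  have hu : φ 1 ∈ Icc (φ 0) (φ 1) := right_mem_Icc.2 h01.le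
  refine ⟨(g ∘ σ) ∘ ρ, hcont.comp (by fun_prop) hρ, ?_, ?_, ?_, fun t _ => hgF _⟩
  · intro s hs t ht hst
    have h1 := (hiff _ (hσC _ (hρ hs)) _ (hσC _ (hρ ht))).2 hst
    rw [hσ _ (hρ hs), hσ _ (hρ ht)] at h1
    exact mul_right_cancel₀ (sub_pos.2 h01).ne' (add_left_cancel h1)
  · have h1 := (hiff _ (hσC _ hl) 0 hC.zero_mem).1 (hσ _ hl)
    simpa [ρ, hg0] using h1
  · have h1 := (hiff _ (hσC _ hu) 1 hC.one_mem).1 (hσ _ hu)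
    simpa [ρ, hg1] using h1

/-- Two arcs with common endpoints, the first of which has its interior disjoint from the second,
form a simple closed curve. -/
theorem exists_injective_circle_of_arcs {X : Type*} [TopologicalSpace X] {g h : ℝ → X}
    (hg : ContinuousOn g (Icc 0 1)) (hh : ContinuousOn h (Icc 0 1))
    (hgi : InjOn g (Icc 0 1)) (hhi : InjOn h (Icc 0 1)) (h10 : g 1 = h 0) (h01 : h 1 = g 0)
    (hgh : ∀ r ∈ Ioo (0 : ℝ) 1, ∀ r' ∈ Icc (0 : ℝ) 1, g r ≠ h r') :
    ∃ ω : Circle → X, Continuous ω ∧ Function.Injective ω := by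
  have : Fact ((0 : ℝ) < 2) := ⟨two_pos⟩
  let w : ℝ → X := fun r => if r ≤ 1 then g r else h (r - 1)
  have hw₁ : ∀ r, r ≤ 1 → w r = g r := fun r hr => if_pos hr
  have hw₂ : ∀ r, 1 ≤ r → w r = h (r - 1) := by
    intro r hr
    rcases hr.eq_or_lt with rfl | hr
    · rw [hw₁ 1 le_rfl, h10, sub_self]
    · exact if_neg (not_le.2 hr)
  have hwc : ContinuousOn w (Icc 0 (0 + 2)) := by
    have h1 : ContinuousOn w (Icc 0 1) := hg.congr fun r hr => hw₁ r hr.2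
    have h2 : ContinuousOn w (Icc 1 2) :=
      (hh.comp (f := fun r : ℝ => r - 1) (by fun_prop)
        (fun r hr => ⟨by linarith [hr.1], by linarith [hr.2]⟩)).congr fun r hr => hw₂ r hr.1
    have h3 := h1.union_of_isClosed h2 isClosed_Icc isClosed_Icc
    rwa [Icc_union_Icc_eq_Icc zero_le_one one_le_two, ← zero_add (2 : ℝ)] at h3
  have hwne : ∀ r s : ℝ, 0 ≤ r → r < s → s < 2 → w r ≠ w s := by
    intro r s hr hrs hs heq
    rcases le_total s 1 with hs1 | hs1
    · rw [hw₁ r (by linarith), hw₁ s hs1] at heq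
      exact hrs.ne (hgi ⟨hr, by linarith⟩ ⟨by linarith, hs1⟩ heq)
    have hs' : s - 1 ∈ Icc (0 : ℝ) 1 := ⟨by linarith, by linarith⟩
    rw [hw₂ s hs1] at heq
    rcases le_or_gt 1 r with hr1 | hr1
    · rw [hw₂ r hr1] at heq
      linarith [hhi ⟨by linarith, by linarith⟩ hs' heq]
    rw [hw₁ r hr1.le] at heq
    rcases hr.eq_or_lt with rfl | hr0
    · rw [← h01] at heq
      linarith [hhi (right_mem_Icc.2 zero_le_one) hs' heq]
    · exact hgh r ⟨hr0, hr1⟩ _ hs' heq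
  have hwi : InjOn w (Ico 0 (0 + 2)) := by
    intro r hr s hs heq
    rw [zero_add] at hr hs
    rcases lt_trichotomy r s with h | h | h
    · exact absurd heq (hwne r s hr.1 h hs.2)
    · exact h
    · exact absurd heq.symm (hwne s r hs.1 h hr.2)
  have hwend : w 0 = w (0 + 2) := by
    rw [hw₁ 0 zero_le_one, hw₂ (0 + 2) (by norm_num), ← h01]
    norm_num
  refine ⟨AddCircle.liftIco 2 0 w ∘ (AddCircle.homeomorphCircle two_ne_zero).symm,
    (AddCircle.liftIco_continuous hwend hwc).comp (Homeomorph.continuous _), ?_⟩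
  refine Function.Injective.comp ?_ (Homeomorph.injective _)
  exact (injOn_iff_injective.1 hwi).comp (Equiv.injective _)

/-- A connected set containing two points contains every point separating them. -/
theorem Separates.mem_of_isPreconnected {X : Type*} [TopologicalSpace X] {x y z : X}
    (h : Separates x y z) {s : Set X} (hs : IsPreconnected s) (hy : y ∈ s) (hz : z ∈ s) :
    x ∈ s := by
  by_contra hx
  exact h.2.2 (connectedComponentIn_eq
    (hs.subset_connectedComponentIn hy (subset_compl_singleton_iff.2 hx) hz))

/-- In a compact locally connected metric space without simple closed curves, the interior points
of an arc separate its endpoints. -/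
theorem separates_of_arc {X : Type*} [MetricSpace X] [CompactSpace X] [LocallyConnectedSpace X]
    (hnoscc : ∀ g : Circle → X, Continuous g → ¬ Function.Injective g) {α : ℝ → X}
    (hα : ContinuousOn α (Icc 0 1)) (hαi : InjOn α (Icc 0 1)) {t : ℝ} (ht : t ∈ Ioo (0 : ℝ) 1) :
    Separates (α t) (α 0) (α 1) := by
  have h0 : (0 : ℝ) ∈ Icc (0 : ℝ) 1 := left_mem_Icc.2 zero_le_one
  have h1 : (1 : ℝ) ∈ Icc (0 : ℝ) 1 := right_mem_Icc.2 zero_le_one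
  have htI : t ∈ Icc (0 : ℝ) 1 := Ioo_subset_Icc_self ht
  have hne0 : α 0 ≠ α t := fun h => ht.1.ne (hαi h0 htI h)
  have hne1 : α 1 ≠ α t := fun h => ht.2.ne' (hαi h1 htI h)
  refine ⟨hne0, hne1, fun hcomp => ?_⟩
  have : LocallyPathConnectedSpace X := locallyPathConnectedSpace_of_compactSpace
  have hW : IsPathConnected (connectedComponentIn {α t}ᶜ (α 0)) := by
    refine (IsOpen.isConnected_iff_isPathConnected ?_).1 ?_
    · exact isOpen_compl_singleton.connectedComponentIn
    · exact isConnected_connectedComponentIn_iff.2 hne0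
  have hjoin := hW.joinedIn (α 0) (mem_connectedComponentIn hne0) (α 1)
    (hcomp ▸ mem_connectedComponentIn hne1)
  obtain ⟨β, hβ, hβi, hβ0, hβ1, hβW⟩ :=
    hjoin.exists_arc (fun h => zero_ne_one (hαi h0 h1 h))
  have hK : IsClosed (β '' Icc 0 1) := (isCompact_Icc.image_of_continuousOn hβ).isClosed
  have htK : α t ∉ β '' Icc 0 1 := by
    rintro ⟨u, hu, hut⟩
    exact connectedComponentIn_subset _ _ (hβW hu) hut
  obtain ⟨s₀, ⟨hs₀, u₀, hu₀, hαβ₀⟩, hmax⟩ := (isCompact_Icc.of_isClosed_subset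
    ((hα.mono (Icc_subset_Icc_right ht.2.le)).preimage_isClosed_of_isClosed isClosed_Icc hK)
    inter_subset_left).exists_isGreatest
    ⟨0, left_mem_Icc.2 ht.1.le, 0, h0, hβ0⟩
  obtain ⟨s₁, ⟨hs₁, u₁, hu₁, hαβ₁⟩, hmin⟩ := (isCompact_Icc.of_isClosed_subset
    ((hα.mono (Icc_subset_Icc_left ht.1.le)).preimage_isClosed_of_isClosed isClosed_Icc hK)
    inter_subset_left).exists_isLeast
    ⟨1, right_mem_Icc.2 ht.2.le, 1, h1, hβ1⟩
  have hs₀t : s₀ < t := lt_of_le_of_ne hs₀.2 fun h => htK (h ▸ ⟨u₀, hu₀, hαβ₀⟩)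
  have hts₁ : t < s₁ := lt_of_le_of_ne hs₁.1 fun h => htK (h ▸ ⟨u₁, hu₁, hαβ₁⟩)
  have hs₀I : s₀ ∈ Icc (0 : ℝ) 1 := ⟨hs₀.1, by linarith [ht.2]⟩
  have hs₁I : s₁ ∈ Icc (0 : ℝ) 1 := ⟨by linarith [ht.1], hs₁.2⟩
  have hu : u₀ ≠ u₁ := by
    rintro rfl
    exact (hs₀t.trans hts₁).ne (hαi hs₀I hs₁I (hαβ₀.symm.trans hαβ₁))
  have hline : ∀ {x y : ℝ}, x ∈ Icc (0 : ℝ) 1 → y ∈ Icc (0 : ℝ) 1 →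
      MapsTo (fun r : ℝ => x + r * (y - x)) (Icc 0 1) (Icc 0 1) := fun {x y} hx hy r hr => by
    constructor
    · nlinarith [mul_nonneg hr.1 hy.1, mul_nonneg (sub_nonneg.2 hr.2) hx.1]
    · nlinarith [mul_nonneg hr.1 (sub_nonneg.2 hy.2),
        mul_nonneg (sub_nonneg.2 hr.2) (sub_nonneg.2 hx.2)]
  have hinj : ∀ {x y : ℝ}, x ≠ y → Function.Injective (fun r : ℝ => x + r * (y - x)) :=
    fun hxy r r' h => mul_right_cancel₀ (sub_ne_zero.2 hxy.symm) (add_left_cancel h)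
  obtain ⟨ω, hω, hωi⟩ := exists_injective_circle_of_arcs
    (hα.comp (by fun_prop) (hline hs₀I hs₁I)) (hβ.comp (by fun_prop) (hline hu₁ hu₀))
    (hαi.comp (hinj (hs₀t.trans hts₁).ne).injOn (hline hs₀I hs₁I))
    (hβi.comp (hinj hu.symm).injOn (hline hu₁ hu₀))
    (by simp [hαβ₁]) (by simp [hαβ₀]) (by
      intro r hr r' hr' heq
      have hmem : α (s₀ + r * (s₁ - s₀)) ∈ β '' Icc 0 1 := ⟨_, hline hu₁ hu₀ hr', heq.symm⟩
      have hlo : s₀ < s₀ + r * (s₁ - s₀) := by nlinarith [hr.1]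
      have hhi : s₀ + r * (s₁ - s₀) < s₁ := by nlinarith [hr.2]
      rcases le_total (s₀ + r * (s₁ - s₀)) t with h | h
      · exact hlo.not_ge (hmax ⟨⟨by linarith [hs₀.1], h⟩, hmem⟩)
      · exact hhi.not_ge (hmin ⟨⟨h, by linarith [hs₁.2]⟩, hmem⟩))
  exact hnoscc ω hω hωi

/-- In a compact locally connected metric space without simple closed curves, points of an arc
separate its initial point from all later points. -/
theorem separates_of_arc_of_lt {X : Type*} [MetricSpace X] [CompactSpace X]
    [LocallyConnectedSpace X]
    (hnoscc : ∀ g : Circle → X, Continuous g → ¬ Function.Injective g) {α : ℝ → X}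
    (hα : ContinuousOn α (Icc 0 1)) (hαi : InjOn α (Icc 0 1)) {s t : ℝ} (hs : 0 < s)
    (hst : s < t) (ht : t ≤ 1) : Separates (α s) (α 0) (α t) := by
  have hsub : Icc t 1 ⊆ Icc (0 : ℝ) 1 := Icc_subset_Icc_left (by linarith)
  have hmiss : α '' Icc t 1 ⊆ {α s}ᶜ := by
    rintro _ ⟨u, hu, rfl⟩ hus
    exact (hst.trans_le hu.1).ne' (hαi (hsub hu) ⟨hs.le, by linarith⟩ hus)
  have htmem : α t ∈ α '' Icc t 1 := mem_image_of_mem α (left_mem_Icc.2 ht)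
  obtain ⟨h0, -, hcomp⟩ := separates_of_arc hnoscc hα hαi ⟨hs, hst.trans_le ht⟩
  refine ⟨h0, hmiss htmem, fun h => hcomp (h.trans ?_)⟩
  have hconn := isPreconnected_Icc.image α (hα.mono hsub)
  exact connectedComponentIn_eq (hconn.subset_connectedComponentIn htmem hmiss
    (mem_image_of_mem α (right_mem_Icc.2 ht)))

/-- If the endpoint of an arc separates its initial point, which is fixed by `f`, from the image of
the endpoint, then it has a backward orbit along the arc whose parameters strictly decrease. -/
theorem exists_backward_orbit_on_arc {X : Type*} [MetricSpace X] [CompactSpace X]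
    [LocallyConnectedSpace X]
    (hnoscc : ∀ g : Circle → X, Continuous g → ¬ Function.Injective g) {f : X → X}
    (hf : Continuous f) {α : ℝ → X} (hα : ContinuousOn α (Icc 0 1)) (hαi : InjOn α (Icc 0 1))
    (hfix : f (α 0) = α 0) (hsep : Separates (α 1) (α 0) (f (α 1))) :
    ∃ τ : ℕ → ℝ, τ 0 = 1 ∧ StrictAnti τ ∧ (∀ n, 0 < τ n) ∧ ∀ n, f (α (τ (n + 1))) = α (τ n) := by
  let T := {t : ℝ // (0 < t ∧ t ≤ 1) ∧ Separates (α t) (α 0) (f (α t))}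
  have hstep : ∀ t : T, ∃ t' : T, t'.1 < t.1 ∧ f (α t'.1) = α t.1 := by
    rintro ⟨t, ⟨ht0, ht1⟩, ht⟩
    obtain ⟨t', ht', heq⟩ := ht.mem_of_isPreconnected
      (isPreconnected_Icc.image _ (hf.comp_continuousOn (hα.mono (Icc_subset_Icc_right ht1))))
      ⟨0, left_mem_Icc.2 ht0.le, hfix⟩ (mem_image_of_mem _ (right_mem_Icc.2 ht0.le))
    have hpos : 0 < t' := lt_of_le_of_ne ht'.1 fun h => ht.1 (by rw [← heq, ← h]; exact hfix.symm)
    have hlt : t' < t := lt_of_le_of_ne ht'.2 fun h => ht.2.1 (by rw [← h] at heq ⊢; exact heq)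
    refine ⟨⟨t', ⟨hpos, hlt.le.trans ht1⟩, ?_⟩, hlt, heq⟩
    have := separates_of_arc_of_lt hnoscc hα hαi hpos hlt ht1
    rwa [← heq] at this
  choose next hlt heq using hstep
  let S : ℕ → T := fun n => next^[n] ⟨1, ⟨one_pos, le_rfl⟩, hsep⟩
  have hS : ∀ n, S (n + 1) = next (S n) := fun n => Function.iterate_succ_apply' _ _ _
  exact ⟨fun n => (S n).1, rfl, strictAnti_nat_of_succ_lt fun n => by rw [hS]; exact hlt _,
    fun n => (S n).2.1.1, fun n => by simp only [hS]; exact heq _⟩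

/-- Let `D` be a dendrite, `f : D → D` continuous, `a` a fixed point, `B` a
component of `D \ {a}` containing points `x` arbitrarily close to `a` that
separate `a` from `f x`, and `U` a neighborhood of `a` in `closure B` whose only
fixed point is `a`. Then there is such an `x` and a backward orbit
`x = x₀, x₋₁, x₋₂, …` in the open arc `(a, x)` (i.e. consisting of points
separating `a` from `x`) with `f x₋ₙ₋₁ = x₋ₙ`, converging to `a`. -/
theorem dendrite_weakly_repelling_backward_orbit {D : Type*} [MetricSpace D]
    [CompactSpace D] [ConnectedSpace D] [LocallyConnectedSpace D]
    (hnoscc : ∀ g : Circle → D, Continuous g → ¬ Function.Injective g)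
    (f : D → D) (hf : Continuous f) (a : D) (ha : f a = a)
    (b : D) (hb : b ≠ a) (B : Set D) (hB : B = connectedComponentIn {a}ᶜ b)
    (U : Set D) (hU : U ∈ nhdsWithin a (closure B))
    (hUfix : ∀ z ∈ U, f z = z → z = a)
    (hsep : ∀ ε > 0, ∃ x ∈ B ∩ U, dist x a < ε ∧ Separates x a (f x)) :
    ∃ x ∈ B ∩ U, Separates x a (f x) ∧
      ∃ s : ℕ → D, s 0 = x ∧ (∀ n, f (s (n + 1)) = s n) ∧
        (∀ n, 1 ≤ n → Separates (s n) a x) ∧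
        Tendsto s atTop (nhds a) := by
  have : LocallyPathConnectedSpace D := locallyPathConnectedSpace_of_compactSpace
  have : PathConnectedSpace D := .of_locallyPathConnectedSpace
  obtain ⟨ε, hε, hεU⟩ := Metric.mem_nhdsWithin_iff.1 hU
  have hV : connectedComponentIn (Metric.ball a ε) a ∈ nhds a :=
    connectedComponentIn_mem_nhds (Metric.ball_mem_nhds a hε)
  obtain ⟨η, hη, hηV⟩ := Metric.mem_nhds_iff.1 hV
  obtain ⟨x, hxBU, hxη, hx⟩ := hsep η hη
  have haB : a ∈ closure B := Metric.mem_closure_iff.2 fun δ hδ => by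
    obtain ⟨y, hy, hyδ, -⟩ := hsep δ hδ
    exact ⟨y, hy.1, by rwa [dist_comm]⟩
  have hBconn : IsPreconnected (insert a B) := by
    refine IsPreconnected.subset_closure ?_ (subset_insert a B) (insert_subset haB subset_closure)
    exact hB ▸ isPreconnected_connectedComponentIn
  obtain ⟨α, hα, hαi, hα0, hα1, -⟩ :=
    (joinedIn_univ.2 (PathConnectedSpace.joined a x)).exists_arc hx.1
  have hαU : ∀ t ∈ Icc (0 : ℝ) 1, α t ∈ U := by
    intro t ht
    rcases ht.1.eq_or_lt with rfl | h0
    · exact hα0 ▸ mem_of_mem_nhdsWithin haB hU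
    rcases ht.2.eq_or_lt with rfl | h1
    · exact hα1 ▸ hxBU.2
    have hsept := separates_of_arc hnoscc hα hαi ⟨h0, h1⟩
    rw [hα0, hα1] at hsept
    refine hεU ⟨connectedComponentIn_subset _ _ (hsept.mem_of_isPreconnected
      isPreconnected_connectedComponentIn (mem_of_mem_nhds hV) (hηV hxη)), ?_⟩
    exact insert_subset haB subset_closure (hsept.mem_of_isPreconnected hBconn
      (mem_insert a B) (mem_insert_of_mem a hxBU.1))
  obtain ⟨τ, hτ0, hτanti, hτpos, hτ⟩ := exists_backward_orbit_on_arc hnoscc hf hα hαi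
    (by rw [hα0, ha]) (by rwa [hα0, hα1])
  have hτI : ∀ n, τ n ∈ Icc (0 : ℝ) 1 := fun n =>
    ⟨(hτpos n).le, hτ0 ▸ hτanti.antitone (Nat.zero_le n)⟩
  have hlim := tendsto_atTop_ciInf hτanti.antitone ⟨0, fun _ ⟨n, hn⟩ => hn ▸ (hτI n).1⟩
  set l := ⨅ n, τ n
  have hlI : l ∈ Icc (0 : ℝ) 1 := isClosed_Icc.mem_of_tendsto hlim (.of_forall hτI)
  have hαlim : Tendsto (fun n => α (τ n)) atTop (nhds (α l)) :=
    (hα l hlI).tendsto.comp (tendsto_nhdsWithin_iff.2 ⟨hlim, .of_forall hτI⟩)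
  have hfl : f (α l) = α l := by
    refine tendsto_nhds_unique ?_ hαlim
    simpa only [Function.comp_def, hτ] using
      (hf.tendsto (α l)).comp (hαlim.comp (tendsto_add_atTop_nat 1))
  refine ⟨x, hxBU, hx, fun n => α (τ n), by simp only [hτ0, hα1], hτ, fun n hn => ?_, ?_⟩
  · have h1 : τ n < 1 := hτ0 ▸ hτanti hn
    have := separates_of_arc hnoscc hα hαi ⟨hτpos n, h1⟩
    rwa [hα0, hα1] at this
  · rwa [hUfix _ (hαU l hlI) hfl] at hαlim
end
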